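/- arXiv:2406.11215 — 2 statements merged into one kernel-verified Lean document; each statement's English description precedes it below -/
import Mathlib

section
/- There exists a constant C > 0 such that for every g ∈ H²(Ω), where Ω = ℝ × 𝕋², one has ‖g‖_{L^∞(Ω)} ≤ C‖g‖_{L²(Ω)}^{1/2}‖∂_{x₁}g‖_{L²(Ω)}^{1/2} + C‖∇g‖_{L²(Ω)}^{1/2}‖∇²g‖_{L²(Ω)}^{1/2}. -/
noncomputable section
open MeasureTheory Set Filter Topology Real

namespace NS3D

abbrev Spc : Type := EuclideanSpace ℝ (Fin 3)

def e (i : Fin 3) : Spc := EuclideanSpace.single i 1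

def PeriodicTD {F : Type*} (f : Spc → F) : Prop :=
  ∀ x : Spc, f (x + e 1) = f x ∧ f (x + e 2) = f x

def cell : Set Spc := {x : Spc | x 1 ∈ Icc (0:ℝ) 1 ∧ x 2 ∈ Icc (0:ℝ) 1}
def cellP : Set Spc := {x : Spc | 0 < x 0 ∧ x 1 ∈ Icc (0:ℝ) 1 ∧ x 2 ∈ Icc (0:ℝ) 1}
def cellM : Set Spc := {x : Spc | x 0 < 0 ∧ x 1 ∈ Icc (0:ℝ) 1 ∧ x 2 ∈ Icc (0:ℝ) 1}
def cube : Set Spc := {x : Spc | x 0 ∈ Icc (0:ℝ) 1 ∧ x 1 ∈ Icc (0:ℝ) 1 ∧ x 2 ∈ Icc (0:ℝ) 1}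

variable {F : Type*} [NormedAddCommGroup F] [NormedSpace ℝ F]

def L2Sq (s : Set Spc) (f : Spc → F) : ℝ := ∫ x in s, ‖f x‖^2
def L2 (s : Set Spc) (f : Spc → F) : ℝ := Real.sqrt (L2Sq s f)
def MemL2 (s : Set Spc) (f : Spc → F) : Prop := IntegrableOn (fun x => ‖f x‖^2) s volume

def DSq (n : ℕ) (f : Spc → F) : ℝ := ∫ x in cell, ‖iteratedFDeriv ℝ n f x‖^2
def MemDSq (n : ℕ) (f : Spc → F) : Prop :=
  IntegrableOn (fun x => ‖iteratedFDeriv ℝ n f x‖^2) cell volume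

def HSq (k : ℕ) (f : Spc → F) : ℝ := ∑ n ∈ Finset.range (k+1), DSq n f
def Hnorm (k : ℕ) (f : Spc → F) : ℝ := Real.sqrt (HSq k f)
def MemH (k : ℕ) (f : Spc → F) : Prop := ∀ n, n ≤ k → MemDSq n f

def GradHSq (k : ℕ) (f : Spc → F) : ℝ := ∑ n ∈ Finset.Icc 1 (k+1), DSq n f
def GradHnorm (k : ℕ) (f : Spc → F) : ℝ := Real.sqrt (GradHSq k f)
def MemGradH (k : ℕ) (f : Spc → F) : Prop := ∀ n, 1 ≤ n → n ≤ k+1 → MemDSq n f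

def ContHk (k : ℕ) (I : Set ℝ) (f : ℝ → Spc → F) : Prop :=
  (∀ t ∈ I, MemH k (f t)) ∧
  ∀ s ∈ I, Tendsto (fun t => HSq k (fun x => f t x - f s x)) (𝓝[I] s) (𝓝 (0:ℝ))

def grad (f : Spc → ℝ) (x : Spc) : Spc :=
  (WithLp.equiv 2 (Fin 3 → ℝ)).symm (fun i => fderiv ℝ f x (e i))
def divg (u : Spc → Spc) (x : Spc) : ℝ := ∑ i, fderiv ℝ (fun y => u y i) x (e i)
def lap (f : Spc → ℝ) (x : Spc) : ℝ :=
  ∑ i, fderiv ℝ (fun y => fderiv ℝ f y (e i)) x (e i)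
def vec3 (a b c : ℝ) : Spc := (WithLp.equiv 2 (Fin 3 → ℝ)).symm ![a, b, c]
def uvec (a : ℝ) : Spc := vec3 a 0 0
def curl (u : Spc → Spc) (x : Spc) : Spc :=
  vec3 (fderiv ℝ (fun y => u y 2) x (e 1) - fderiv ℝ (fun y => u y 1) x (e 2))
       (fderiv ℝ (fun y => u y 0) x (e 2) - fderiv ℝ (fun y => u y 2) x (e 0))
       (fderiv ℝ (fun y => u y 1) x (e 0) - fderiv ℝ (fun y => u y 0) x (e 1))

def pfn (γ v : ℝ) : ℝ := v ^ (-γ)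
def pderivfn (γ v : ℝ) : ℝ := -γ * v ^ (-γ - 1)
def Qfn (γ v : ℝ) : ℝ := v ^ (1 - γ) / (γ - 1)
def pRel (γ v w : ℝ) : ℝ := pfn γ v - pfn γ w - pderivfn γ w * (v - w)
def QRel (γ v w : ℝ) : ℝ := Qfn γ v - Qfn γ w + pfn γ w * (v - w)

structure RHLax (γ σ1s σ2s vminus uminus vm um vplus uplus : ℝ) : Prop where
  posminus : 0 < vminus
  posm : 0 < vm
  posplus : 0 < vplus
  rh1v : -σ1s * (vm - vminus) = um - uminus
  rh1u : -σ1s * (um - uminus) + (pfn γ vm - pfn γ vminus) = 0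
  lax1v : vm < vminus
  lax1u : um < uminus
  rh2v : -σ2s * (vplus - vm) = uplus - um
  rh2u : -σ2s * (uplus - um) + (pfn γ vplus - pfn γ vm) = 0
  lax2v : vm < vplus
  lax2u : uplus < um

structure ViscousShock (γ μ lam σs vL uL vR uR : ℝ) (vt ut : ℝ → ℝ) : Prop where
  smooth_v : ContDiff ℝ 3 vt
  smooth_u : ContDiff ℝ 3 ut
  pos : ∀ ξ, 0 < vt ξ
  ode1 : ∀ ξ, -σs * deriv vt ξ = deriv ut ξ
  ode2 : ∀ ξ, -σs * deriv ut ξ + deriv (fun y => pfn γ (vt y)) ξ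
            = (2*μ+lam) * deriv (deriv ut) ξ
  limL_v : Tendsto vt atBot (𝓝 vL)
  limL_u : Tendsto ut atBot (𝓝 uL)
  limR_v : Tendsto vt atTop (𝓝 vR)
  limR_u : Tendsto ut atTop (𝓝 uR)

def heff (μ lam : ℝ) (vt ut : ℝ → ℝ) (ξ : ℝ) : ℝ := ut ξ - (2*μ+lam) * deriv vt ξ
def wgt (γ δ ν vm : ℝ) (vt : ℝ → ℝ) (ξ : ℝ) : ℝ := 1 + ν * (pfn γ vm - pfn γ (vt ξ)) / δ

def vcompY (c σ1 σ2 : ℝ) (f1 f2 : ℝ → ℝ) (t Y1 Y2 x1 : ℝ) : ℝ :=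
  f1 (x1 - σ1*t - Y1) + f2 (x1 - σ2*t - Y2) - c
def acompY (γ vm σ1 σ2 δ1 δ2 ν1 ν2 : ℝ) (vt1 vt2 : ℝ → ℝ) (t Y1 Y2 x1 : ℝ) : ℝ :=
  wgt γ δ1 ν1 vm vt1 (x1 - σ1*t - Y1) + wgt γ δ2 ν2 vm vt2 (x1 - σ2*t - Y2) - 1

def sigm (γ vm : ℝ) : ℝ := Real.sqrt (γ * vm ^ (-γ - 1))
def alpham (γ vm : ℝ) : ℝ := (γ + 1) / (2 * γ * sigm γ vm * pfn γ vm)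
def Mconst (γ vm : ℝ) : ℝ := (5/4) * (sigm γ vm)^4 * vm^2 * alpham γ vm

def cutoff1 (σ1 σ2 t x1 : ℝ) : ℝ :=
  if x1 ≤ (3*σ1+σ2)/4 * t then 1
  else if (σ1+3*σ2)/4 * t ≤ x1 then 0
  else ((σ1+3*σ2)/4 * t - x1) / ((σ1+3*σ2)/4 * t - (3*σ1+σ2)/4 * t)
def cutoff2 (σ1 σ2 t x1 : ℝ) : ℝ := 1 - cutoff1 σ1 σ2 t x1

def shiftF1 (γ μ lam vm σ1 σ2 σ1s δ1 δ2 ν1 ν2 M : ℝ) (vt1 ut1 vt2 : ℝ → ℝ)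
    (v : ℝ → Spc → ℝ) (t Y1 Y2 : ℝ) : ℝ :=
  -(M/δ1) *
    ((∫ x in cell, (acompY γ vm σ1 σ2 δ1 δ2 ν1 ν2 vt1 vt2 t Y1 Y2 (x 0) / σ1s)
        * deriv (heff μ lam vt1 ut1) (x 0 - σ1*t - Y1)
        * (pfn γ (v t x) - pfn γ (vcompY vm σ1 σ2 vt1 vt2 t Y1 Y2 (x 0))))
     - ∫ x in cell, acompY γ vm σ1 σ2 δ1 δ2 ν1 ν2 vt1 vt2 t Y1 Y2 (x 0)
        * deriv (fun y => pfn γ (vt1 y)) (x 0 - σ1*t - Y1)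
        * (v t x - vcompY vm σ1 σ2 vt1 vt2 t Y1 Y2 (x 0)))
def shiftF2 (γ μ lam vm σ1 σ2 σ2s δ1 δ2 ν1 ν2 M : ℝ) (vt1 vt2 ut2 : ℝ → ℝ)
    (v : ℝ → Spc → ℝ) (t Y1 Y2 : ℝ) : ℝ :=
  -(M/δ2) *
    ((∫ x in cell, (acompY γ vm σ1 σ2 δ1 δ2 ν1 ν2 vt1 vt2 t Y1 Y2 (x 0) / σ2s)
        * deriv (heff μ lam vt2 ut2) (x 0 - σ2*t - Y2)
        * (pfn γ (v t x) - pfn γ (vcompY vm σ1 σ2 vt1 vt2 t Y1 Y2 (x 0))))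
     - ∫ x in cell, acompY γ vm σ1 σ2 δ1 δ2 ν1 ν2 vt1 vt2 t Y1 Y2 (x 0)
        * deriv (fun y => pfn γ (vt2 y)) (x 0 - σ2*t - Y2)
        * (v t x - vcompY vm σ1 σ2 vt1 vt2 t Y1 Y2 (x 0)))

def ShiftODE (γ μ lam vm σ1 σ2 σ1s σ2s δ1 δ2 ν1 ν2 T : ℝ)
    (vt1 ut1 vt2 ut2 : ℝ → ℝ) (v : ℝ → Spc → ℝ) (X1 X2 dX1 dX2 : ℝ → ℝ) : Prop :=
  X1 0 = 0 ∧ X2 0 = 0 ∧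
  ∀ t ∈ Icc 0 T,
    HasDerivAt X1 (dX1 t) t ∧ HasDerivAt X2 (dX2 t) t ∧
    dX1 t = shiftF1 γ μ lam vm σ1 σ2 σ1s δ1 δ2 ν1 ν2 (Mconst γ vm) vt1 ut1 vt2 v t (X1 t) (X2 t) ∧
    dX2 t = shiftF2 γ μ lam vm σ1 σ2 σ2s δ1 δ2 ν1 ν2 (Mconst γ vm) vt1 vt2 ut2 v t (X1 t) (X2 t)

def NSvol (γ μ lam : ℝ) (I : Set ℝ) (v : ℝ → Spc → ℝ) (u : ℝ → Spc → Spc) : Prop :=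
  (∀ t ∈ I, PeriodicTD (v t) ∧ PeriodicTD (u t)) ∧
  ∀ t ∈ I, ∀ x : Spc,
    0 < v t x ∧
    (1 / v t x) * (deriv (fun s => v s x) t + fderiv ℝ (v t) x (u t x)) = divg (u t) x ∧
    (1 / v t x) • (deriv (fun s => u s x) t
        + (WithLp.equiv 2 (Fin 3 → ℝ)).symm (fun i => fderiv ℝ (fun y => u t y i) x (u t x)))
      + grad (fun y => pfn γ (v t y)) x
    = (2*μ+lam) • grad (fun y => divg (u t) y) x - μ • curl (curl (u t)) x

def NSdens (γ b μ lam : ℝ) (I : Set ℝ) (ρ : ℝ → Spc → ℝ) (u : ℝ → Spc → Spc) : Prop :=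
  (∀ t ∈ I, PeriodicTD (ρ t) ∧ PeriodicTD (u t)) ∧
  ∀ t ∈ I, ∀ x : Spc,
    0 < ρ t x ∧
    (deriv (fun s => ρ s x) t + divg (fun y => ρ t y • u t y) x = 0) ∧
    ∀ i : Fin 3,
      deriv (fun s => ρ s x * u s x i) t
        + divg (fun y => (ρ t y * u t y i) • u t y) x
        + fderiv ℝ (fun y => b * ρ t y ^ γ) x (e i)
      = μ * lap (fun y => u t y i) x
        + (μ+lam) * fderiv ℝ (fun y => divg (u t) y) x (e i)

structure RHLaxDens (γ b σ1 σ2 ρminus uminus ρm um ρplus uplus : ℝ) : Prop where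
  posminus : 0 < ρminus
  posm : 0 < ρm
  posplus : 0 < ρplus
  rh1m : -σ1 * (ρm - ρminus) + (ρm * um - ρminus * uminus) = 0
  rh1mom : -σ1 * (ρm * um - ρminus * uminus) + (ρm * um^2 - ρminus * uminus^2)
      + (b * ρm ^ γ - b * ρminus ^ γ) = 0
  lax1ρ : ρminus < ρm
  lax1u : um < uminus
  rh2m : -σ2 * (ρplus - ρm) + (ρplus * uplus - ρm * um) = 0
  rh2mom : -σ2 * (ρplus * uplus - ρm * um) + (ρplus * uplus^2 - ρm * um^2)
      + (b * ρplus ^ γ - b * ρm ^ γ) = 0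
  lax2ρ : ρplus < ρm
  lax2u : uplus < um

structure ViscousShockDens (γ b μ lam σ ρL uL ρR uR : ℝ) (ρt ut : ℝ → ℝ) : Prop where
  smooth_ρ : ContDiff ℝ 3 ρt
  smooth_u : ContDiff ℝ 3 ut
  pos : ∀ ξ, 0 < ρt ξ
  ode1 : ∀ ξ, -σ * deriv ρt ξ + deriv (fun y => ρt y * ut y) ξ = 0
  ode2 : ∀ ξ, -σ * deriv (fun y => ρt y * ut y) ξ + deriv (fun y => ρt y * (ut y)^2) ξ
        + deriv (fun y => b * ρt y ^ γ) ξ = (2*μ+lam) * deriv (deriv ut) ξ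
  limL_ρ : Tendsto ρt atBot (𝓝 ρL)
  limL_u : Tendsto ut atBot (𝓝 uL)
  limR_ρ : Tendsto ρt atTop (𝓝 ρR)
  limR_u : Tendsto ut atTop (𝓝 uR)


/-- The lattice of transversal periods. -/
def latt : AddSubgroup Spc := AddSubgroup.closure {e 1, e 2}

/-- Half-open translated cell. -/
def slab (a : Spc) : Set Spc := {z | z 1 ∈ Ioc (a 1) (a 1 + 1) ∧ z 2 ∈ Ioc (a 2) (a 2 + 1)}

lemma mem_latt {z : Spc} : z ∈ latt ↔ ∃ m n : ℤ, m • e 1 + n • e 2 = z :=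
  AddSubgroup.mem_closure_pair

lemma latt_countable : Countable latt := by
  have : (latt : Set Spc) ⊆ Set.range (fun p : ℤ × ℤ => p.1 • e 1 + p.2 • e 2) := by
    intro z hz
    obtain ⟨m, n, h⟩ := mem_latt.1 hz
    exact ⟨(m, n), h⟩
  exact (Set.countable_range _).mono this

lemma coord_cont (i : Fin 3) : Continuous (fun z : Spc => z i) := by fun_prop

lemma slab_meas (a : Spc) : MeasurableSet (slab a) :=
  ((coord_cont 1).measurable measurableSet_Ioc).inter ((coord_cont 2).measurable measurableSet_Ioc)

lemma slab_fund (a : Spc) : IsAddFundamentalDomain latt (slab a) volume := by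
  refine IsAddFundamentalDomain.mk' (slab_meas a).nullMeasurableSet ?_
  intro x
  obtain ⟨m, hm, hm'⟩ := existsUnique_add_zsmul_mem_Ioc (one_pos) (x 1) (a 1)
  obtain ⟨n, hn, hn'⟩ := existsUnique_add_zsmul_mem_Ioc (one_pos) (x 2) (a 2)
  refine ⟨⟨m • e 1 + n • e 2, mem_latt.2 ⟨m, n, rfl⟩⟩, ?_, ?_⟩
  · simp only [AddSubgroup.vadd_def, vadd_eq_add, slab, mem_ofPred_eq]
    constructor
    · simpa [e, add_comm] using hm
    · simpa [e, add_comm] using hn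
  · rintro ⟨y, hy⟩ h
    obtain ⟨m', n', rfl⟩ := mem_latt.1 hy
    simp only [AddSubgroup.vadd_def, vadd_eq_add, slab, mem_ofPred_eq] at h
    have h1 := hm' m' (by simpa [e, add_comm] using h.1)
    have h2 := hn' n' (by simpa [e, add_comm] using h.2)
    subst h1 h2
    rfl

lemma periodic_latt {E : Type*} {F : Spc → E} (hF : PeriodicTD F) (g : latt) (x : Spc) :
    F (g +ᵥ x) = F x := by
  obtain ⟨y, hy⟩ := g
  simp only [AddSubgroup.vadd_def, vadd_eq_add]
  induction hy using AddSubgroup.closure_induction generalizing x with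
  | mem y hy =>
    rcases hy with rfl | rfl
    · rw [add_comm]; exact (hF x).1
    · rw [add_comm]; exact (hF x).2
  | zero => simp
  | add y z _ _ h1 h2 => rw [add_assoc, h1, h2]
  | neg y _ h => rw [← h (-y + x)]; simp

lemma slab_integral {E : Type*} [NormedAddCommGroup E] [NormedSpace ℝ E] {F : Spc → E}
    (hF : PeriodicTD F) (a b : Spc) : ∫ z in slab a, F z = ∫ z in slab b, F z := by
  have := latt_countable
  exact (slab_fund a).setIntegral_eq (slab_fund b) (periodic_latt hF)

lemma slab_integrable {E : Type*} [NormedAddCommGroup E] {F : Spc → E}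
    (hF : PeriodicTD F) (a b : Spc) : IntegrableOn F (slab a) ↔ IntegrableOn F (slab b) := by
  have := latt_countable
  exact (slab_fund a).integrableOn_iff (slab_fund b) (periodic_latt hF)

lemma slab_zero_subset : slab 0 ⊆ cell := by
  rintro z ⟨h1, h2⟩
  simp only [PiLp.zero_apply, zero_add] at h1 h2
  exact ⟨Ioc_subset_Icc_self h1, Ioc_subset_Icc_self h2⟩

/-- The unit box. -/
def Q : Set (Fin 3 → ℝ) := Set.pi univ (fun _ => Ioc 0 1)

lemma Q_meas : MeasurableSet Q := MeasurableSet.univ_pi fun _ => measurableSet_Ioc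

/-- Lebesgue measure on the unit box. -/
def muQ : Measure (Fin 3 → ℝ) := volume.restrict Q

instance : IsProbabilityMeasure muQ := ⟨by simp [muQ, Q, volume_pi, Measure.pi_pi]⟩

/-- The affine dilation. -/
def dil (x : Spc) (d y : Fin 3 → ℝ) : Spc := x + WithLp.toLp 2 (d * y)

lemma dil_cont (x : Spc) (d : Fin 3 → ℝ) : Continuous (dil x d) := by
  unfold dil; fun_prop

lemma muQ_integrable {E : Type*} [NormedAddCommGroup E] {F : (Fin 3 → ℝ) → E}
    (hF : Continuous F) : Integrable F muQ := by
  have : IntegrableOn F (Set.pi univ (fun _ => Icc 0 1)) volume :=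
    hF.continuousOn.integrableOn_compact (isCompact_univ_pi fun _ => isCompact_Icc)
  exact this.mono_set (Set.pi_mono fun _ _ => Ioc_subset_Icc_self)


/-- The box `x + d Q`. -/
def box (x : Spc) (d : Fin 3 → ℝ) : Set Spc := {z | ∀ i, z i ∈ Ioc (x i) (x i + d i)}

lemma box_meas (x : Spc) (d : Fin 3 → ℝ) : MeasurableSet (box x d) := by
  have : box x d = ⋂ i, (fun z : Spc => z i) ⁻¹' Ioc (x i) (x i + d i) := by
    ext z; simp [box]
  rw [this]
  exact MeasurableSet.iInter fun i => (coord_cont i).measurable measurableSet_Ioc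

lemma vol_map {d : Fin 3 → ℝ} (hd : ∀ i, 0 < d i) (x : Spc) :
    (volume : Measure (Fin 3 → ℝ)).map (dil x d)
      = ENNReal.ofReal (d 0 * d 1 * d 2)⁻¹ • (volume : Measure Spc) := by
  have hdet : (Matrix.diagonal d).det = d 0 * d 1 * d 2 := by
    simp [Matrix.det_diagonal, Fin.prod_univ_three]
  have hpos : 0 < d 0 * d 1 * d 2 := mul_pos (mul_pos (hd 0) (hd 1)) (hd 2)
  have h1 := Real.map_matrix_volume_pi_eq_smul_volume_pi (M := Matrix.diagonal d)
    (by rw [hdet]; exact hpos.ne')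
  rw [hdet, abs_of_pos (inv_pos.2 hpos)] at h1
  have h2 : dil x d = (fun z => x + z) ∘ (WithLp.toLp 2) ∘ (Matrix.toLin' (Matrix.diagonal d)) := by
    ext y i
    simp [dil, Matrix.mulVec_diagonal]
  have m1 : Measurable (Matrix.toLin' (Matrix.diagonal d)) :=
    (LinearMap.continuous_of_finiteDimensional _).measurable
  have m2 := (PiLp.volume_preserving_toLp (Fin 3))
  rw [h2, ← Measure.map_map (measurable_const_add x) (m2.measurable.comp m1),
    ← Measure.map_map m2.measurable m1, h1, Measure.map_smul, m2.map_eq, Measure.map_smul,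
    map_add_left_eq_self]

lemma muQ_map {d : Fin 3 → ℝ} (hd : ∀ i, 0 < d i) (x : Spc) :
    muQ.map (dil x d) = ENNReal.ofReal (d 0 * d 1 * d 2)⁻¹ • volume.restrict (box x d) := by
  have hQ : Q = dil x d ⁻¹' (box x d) := by
    ext y
    simp only [Q, box, dil, Set.mem_pi, mem_univ, true_implies, mem_preimage, mem_ofPred_eq, mem_Ioc,
      PiLp.add_apply, Pi.mul_apply, lt_add_iff_pos_right, add_le_add_iff_left]
    refine forall_congr' fun i => and_congr ?_ ?_
    · exact (mul_pos_iff_of_pos_left (hd i)).symm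
    · exact (mul_le_iff_le_one_right (hd i)).symm
  rw [muQ, hQ, ← Measure.restrict_map (dil_cont x d).measurable (box_meas x d), vol_map hd,
    Measure.restrict_smul]

lemma integral_dil {d : Fin 3 → ℝ}
    (hd : ∀ i, 0 < d i) (x : Spc) {W : Spc → ℝ} (hW : Continuous W) :
    ∫ y, W (dil x d y) ∂muQ = (d 0 * d 1 * d 2)⁻¹ • ∫ z in box x d, W z := by
  have hpos : 0 < d 0 * d 1 * d 2 := mul_pos (mul_pos (hd 0) (hd 1)) (hd 2)
  have : AEStronglyMeasurable W (muQ.map (dil x d)) := hW.aestronglyMeasurable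
  rw [← integral_map (dil_cont x d).measurable.aemeasurable this, muQ_map hd, integral_smul_measure,
    ENNReal.toReal_ofReal (inv_pos.2 hpos).le]

lemma integral_dil_le {d : Fin 3 → ℝ}
    (hd : ∀ i, 0 < d i) (h1 : d 1 ≤ 1) (h2 : d 2 ≤ 1) (x : Spc) {W : Spc → ℝ}
    (hW : Continuous W) (hW0 : ∀ z, 0 ≤ W z) (hp : PeriodicTD W) (hi : IntegrableOn W cell) :
    ∫ y, W (dil x d y) ∂muQ ≤ (d 0 * d 1 * d 2)⁻¹ * ∫ z in cell, W z := by
  have hpos : 0 < d 0 * d 1 * d 2 := mul_pos (mul_pos (hd 0) (hd 1)) (hd 2)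
  rw [integral_dil hd x hW, smul_eq_mul]
  refine mul_le_mul_of_nonneg_left ?_ (inv_pos.2 hpos).le
  have hsub : box x d ⊆ slab x := by
    intro z hz
    exact ⟨⟨(hz 1).1, (hz 1).2.trans (by linarith)⟩, ⟨(hz 2).1, (hz 2).2.trans (by linarith)⟩⟩
  have hi0 : IntegrableOn W (slab 0) := hi.mono_set slab_zero_subset
  calc ∫ z in box x d, W z ≤ ∫ z in slab x, W z :=
        setIntegral_mono_set ((slab_integrable hp x 0).2 hi0) (ae_of_all _ hW0)
          (LE.le.eventuallyLE hsub)
    _ = ∫ z in slab 0, W z := slab_integral hp x 0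
    _ ≤ ∫ z in cell, W z :=
        setIntegral_mono_set hi (ae_of_all _ hW0) (LE.le.eventuallyLE slab_zero_subset)

lemma muQ_cs {f : (Fin 3 → ℝ) → ℝ} (hf : Continuous f) :
    ∫ y, f y ∂muQ ≤ Real.sqrt (∫ y, f y ^ 2 ∂muQ) := by
  apply Real.le_sqrt_of_sq_le
  set m := ∫ y, f y ∂muQ with hm
  have h0 : 0 ≤ ∫ y, (f y - m) ^ 2 ∂muQ := integral_nonneg fun y => sq_nonneg _
  have h1 : ∫ y, (f y - m) ^ 2 ∂muQ = (∫ y, f y ^ 2 ∂muQ) - 2 * m * m + m ^ 2 := by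
    have : ∀ y, (f y - m) ^ 2 = f y ^ 2 - (2 * m) * f y + m ^ 2 := fun y => by ring
    simp_rw [this]
    rw [integral_add (muQ_integrable (by fun_prop)) (muQ_integrable (by fun_prop)),
      integral_sub (muQ_integrable (by fun_prop)) (muQ_integrable (by fun_prop)),
      integral_const_mul, ← hm]
    simp
  nlinarith

lemma norm_dil_le {E : Type*} [NormedAddCommGroup E] {d : Fin 3 → ℝ}
    (hd : ∀ i, 0 < d i) (h1 : d 1 ≤ 1) (h2 : d 2 ≤ 1) (x : Spc) {w : Spc → E}
    (hw : Continuous w) (hp : PeriodicTD w) (hi : IntegrableOn (fun z => ‖w z‖ ^ 2) cell) :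
    ∫ y, ‖w (dil x d y)‖ ∂muQ ≤ Real.sqrt (d 0 * d 1 * d 2)⁻¹ * Real.sqrt (∫ z in cell, ‖w z‖ ^ 2) := by
  have hpos : 0 < d 0 * d 1 * d 2 := mul_pos (mul_pos (hd 0) (hd 1)) (hd 2)
  refine (muQ_cs ((hw.comp (dil_cont x d)).norm)).trans ?_
  rw [← Real.sqrt_mul (inv_pos.2 hpos).le]
  apply Real.sqrt_le_sqrt
  exact integral_dil_le hd h1 h2 x (W := fun z => ‖w z‖ ^ 2) (by fun_prop) (fun z => by positivity)
    (fun z => by simp only [(hp z).1, (hp z).2, and_self]) hi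

lemma avg_shift {g : Spc → ℝ} (hg : Continuous g) (hp : PeriodicTD g) (x t : Spc) (ht : t 0 = 0) :
    ∫ y, g (dil (x + t) 1 y) ∂muQ = ∫ y, g (dil x 1 y) ∂muQ := by
  rw [integral_dil (by simp) _ hg, integral_dil (by simp) _ hg]
  congr 1
  set T : Set Spc := {z | z 0 ∈ Ioc (x 0) (x 0 + 1)} with hT
  have hTm : MeasurableSet T := (coord_cont 0).measurable measurableSet_Ioc
  have key : ∀ s : Spc, s 0 = x 0 → ∫ z in box s 1, g z = ∫ z in slab s, T.indicator g z := by
    intro s hs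
    rw [setIntegral_indicator hTm]
    congr 2
    ext z
    simp only [box, slab, hT, mem_inter_iff, mem_ofPred_eq, Fin.forall_fin_succ, hs, Pi.one_apply]
    simp
    tauto
  rw [key _ (by simp [ht]), key _ rfl]
  apply slab_integral
  intro z
  simp [Set.indicator, hT, e]
  have := hp z
  simp only [e] at this
  rw [this.1, this.2]
  simp

lemma swap_int {F : ℝ → (Fin 3 → ℝ) → ℝ} (hF : Continuous (Function.uncurry F)) (a b : ℝ) :
    ∫ y, (∫ r in a..b, F r y) ∂muQ = ∫ r in a..b, (∫ y, F r y ∂muQ) := by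
  symm
  apply intervalIntegral_integral_swap
  have h : IntegrableOn (Function.uncurry F) (uIcc a b ×ˢ Set.pi univ (fun _ => Icc 0 1))
      (volume.prod volume) :=
    hF.continuousOn.integrableOn_compact
      (isCompact_uIcc.prod (isCompact_univ_pi fun _ => isCompact_Icc))
  rw [muQ, Measure.prod_restrict]
  exact h.mono_set (Set.prod_mono uIoc_subset_uIcc (Set.pi_mono fun _ _ => Ioc_subset_Icc_self))

lemma swap_cont {F : ℝ → (Fin 3 → ℝ) → ℝ} (hF : Continuous (Function.uncurry F)) :
    Continuous (fun r => ∫ y, F r y ∂muQ) := by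
  have : ∀ r, ∫ y, F r y ∂muQ = ∫ y in Set.pi univ (fun _ => Icc 0 1), F r y := by
    intro r
    rw [muQ]
    apply setIntegral_congr_set
    have := Measure.univ_pi_Ioc_ae_eq_Icc (μ := fun _ : Fin 3 => (volume : Measure ℝ))
      (f := fun _ => 0) (g := fun _ => 1)
    rw [← Set.pi_univ_Icc] at this
    exact this
  simp_rw [this]
  exact continuous_parametric_integral_of_continuous hF
    (isCompact_univ_pi fun _ => isCompact_Icc)

lemma inner_cont {F : ℝ → (Fin 3 → ℝ) → ℝ} (hF : Continuous (Function.uncurry F)) (a b : ℝ) :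
    Continuous (fun y => ∫ r in a..b, F r y) := by
  apply intervalIntegral.continuous_parametric_intervalIntegral_of_continuous'
  exact hF.comp continuous_swap

lemma opt {X p q α β : ℝ} (hα : 0 ≤ α) (hβ : 0 ≤ β)
    (h : ∀ σ > 0, (α ≤ β → σ ≤ 1) → X ≤ p * α / σ + q * β * σ) (hp : 0 ≤ p) (hq : 0 ≤ q) :
    X ≤ (p + q) * (Real.sqrt α * Real.sqrt β) := by
  have key : ∀ ε > 0, X ≤ (p + q) * (Real.sqrt (α + ε) * Real.sqrt (β + ε)) := by
    intro ε hε
    have ha : 0 < Real.sqrt (α + ε) := Real.sqrt_pos.2 (by linarith)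
    have hb : 0 < Real.sqrt (β + ε) := Real.sqrt_pos.2 (by linarith)
    have ha2 := Real.sq_sqrt (show 0 ≤ α + ε by linarith)
    have hb2 := Real.sq_sqrt (show 0 ≤ β + ε by linarith)
    set s := Real.sqrt (α + ε)
    set t := Real.sqrt (β + ε)
    have h1 := h (s / t) (by positivity) (fun hab => by
      rw [div_le_one hb]
      exact Real.sqrt_le_sqrt (by linarith))
    refine h1.trans ?_
    have e1 : p * α / (s / t) ≤ p * (s ^ 2) / (s / t) := by
      gcongr; linarith
    have e2 : q * β * (s / t) ≤ q * t ^ 2 * (s / t) := by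
      gcongr; linarith
    have e3 : p * (s ^ 2) / (s / t) + q * t ^ 2 * (s / t) = (p + q) * (s * t) := by
      field_simp
    linarith
  have hc : Tendsto (fun ε => (p + q) * (Real.sqrt (α + ε) * Real.sqrt (β + ε))) (𝓝[>] 0)
      (𝓝 ((p + q) * (Real.sqrt α * Real.sqrt β))) := by
    have : Continuous (fun ε => (p + q) * (Real.sqrt (α + ε) * Real.sqrt (β + ε))) := by fun_prop
    have := this.tendsto 0
    simp only [add_zero] at this
    exact this.mono_left nhdsWithin_le_nhds
  exact ge_of_tendsto hc (eventually_mem_nhdsWithin.mono fun ε hε => key ε hε)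

lemma Q_norm {y : Fin 3 → ℝ} (hy : y ∈ Q) : ‖(WithLp.toLp 2 y : Spc)‖ ≤ 2 := by
  rw [EuclideanSpace.norm_eq]
  apply Real.sqrt_le_iff.2 ⟨by norm_num, ?_⟩
  have h : ∀ i, ‖y i‖ ^ 2 ≤ 1 := by
    intro i
    have := hy i (mem_univ i)
    rw [Real.norm_eq_abs, sq_abs]
    nlinarith [this.1, this.2]
  simp only [Fin.sum_univ_three]
  linarith [h 0, h 1, h 2]

lemma ae_Q {P : (Fin 3 → ℝ) → Prop} (h : ∀ y ∈ Q, P y) : ∀ᵐ y ∂muQ, P y :=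
  (ae_restrict_iff' Q_meas).2 (ae_of_all _ h)

lemma dil_const (x : Spc) (r : ℝ) (y : Fin 3 → ℝ) :
    dil x (fun _ => r) y = x + r • WithLp.toLp 2 y := by
  ext i; simp [dil]

lemma hess_norm_cont {f : Spc → ℝ} (hf : ContDiff ℝ 2 f) :
    Continuous fun z => ‖fderiv ℝ (fderiv ℝ f) z‖ := by
  have hf' : ContDiff ℝ 1 (fderiv ℝ f) := hf.fderiv_right (by norm_num)
  have c2 : Continuous (fderiv ℝ (fderiv ℝ f)) := hf'.continuous_fderiv (by norm_num)
  exact Continuous.norm (E := Spc →L[ℝ] Spc →L[ℝ] ℝ) c2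

lemma line_bound {f : Spc → ℝ} (hf : ContDiff ℝ 2 f) (x Y : Spc) (hY : ‖Y‖ ≤ 2) {ρ : ℝ}
    (h0 : 0 < ρ) (h1 : ρ ≤ 1) :
    |f x - f (x + (1:ℝ) • Y)| ≤ 2 * (∫ r in ρ..1, ‖fderiv ℝ f (x + r • Y)‖)
      + 2 * ρ * ‖fderiv ℝ f (x + ρ • Y)‖
      + 4 * ∫ r in (0:ℝ)..ρ, r * ‖fderiv ℝ (fderiv ℝ f) (x + r • Y)‖ := by
  have hd1 : Differentiable ℝ f := hf.differentiable (by norm_num)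
  have hf' : ContDiff ℝ 1 (fderiv ℝ f) := hf.fderiv_right (by norm_num)
  have hd2 : Differentiable ℝ (fderiv ℝ f) := hf'.differentiable (by norm_num)
  have c1 : Continuous (fderiv ℝ f) := hf'.continuous
  have c2 : Continuous (fderiv ℝ (fderiv ℝ f)) := hf'.continuous_fderiv (by norm_num)
  have hp : ∀ r : ℝ, HasDerivAt (fun r : ℝ => x + r • Y) Y r := by
    intro r
    simpa using ((hasDerivAt_id r).smul_const Y).const_add x
  have hu : ∀ r : ℝ, HasDerivAt (fun r : ℝ => f (x + r • Y)) (fderiv ℝ f (x + r • Y) Y) r :=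
    fun r => (hd1 _).hasFDerivAt.comp_hasDerivAt r (hp r)
  have hu' : ∀ r : ℝ, HasDerivAt (fun r : ℝ => fderiv ℝ f (x + r • Y) Y)
      (fderiv ℝ (fderiv ℝ f) (x + r • Y) Y Y) r := by
    intro r
    have := ((hd2 (x + r • Y)).hasFDerivAt.comp_hasDerivAt r (hp r))
    simpa using this.clm_apply (hasDerivAt_const r Y)
  have i1 : ∫ r in ρ..1, fderiv ℝ f (x + r • Y) Y = f (x + (1:ℝ) • Y) - f (x + ρ • Y) :=
    intervalIntegral.integral_eq_sub_of_hasDerivAt (fun r _ => hu r)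
      (Continuous.intervalIntegrable (by fun_prop) _ _)
  have i2 : ∫ r in (0:ℝ)..ρ, r * fderiv ℝ (fderiv ℝ f) (x + r • Y) Y Y
      = (ρ * fderiv ℝ f (x + ρ • Y) Y - f (x + ρ • Y)) - (0 * fderiv ℝ f (x + (0:ℝ) • Y) Y - f (x + (0:ℝ) • Y)) := by
    apply intervalIntegral.integral_eq_sub_of_hasDerivAt
      (f := fun r => r * fderiv ℝ f (x + r • Y) Y - f (x + r • Y))
    · intro r _
      have := ((hasDerivAt_id r).mul (hu' r)).sub (hu r)
      refine this.congr_deriv ?_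
      simp only [id]
      ring
    · exact Continuous.intervalIntegrable (by fun_prop) _ _
  have n1 : ∀ r : ℝ, |fderiv ℝ f (x + r • Y) Y| ≤ 2 * ‖fderiv ℝ f (x + r • Y)‖ := by
    intro r
    have := (fderiv ℝ f (x + r • Y)).le_opNorm Y
    rw [Real.norm_eq_abs] at this
    nlinarith [norm_nonneg (fderiv ℝ f (x + r • Y))]
  have n2 : ∀ r : ℝ, |fderiv ℝ (fderiv ℝ f) (x + r • Y) Y Y|
      ≤ 4 * ‖fderiv ℝ (fderiv ℝ f) (x + r • Y)‖ := by
    intro r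
    have := (fderiv ℝ (fderiv ℝ f) (x + r • Y)).le_opNorm₂ Y Y
    rw [Real.norm_eq_abs] at this
    have h4 : ‖Y‖ * ‖Y‖ ≤ 4 := by nlinarith [norm_nonneg Y]
    nlinarith [norm_nonneg (fderiv ℝ (fderiv ℝ f) (x + r • Y))]
  have b1 : |∫ r in ρ..1, fderiv ℝ f (x + r • Y) Y| ≤ 2 * ∫ r in ρ..1, ‖fderiv ℝ f (x + r • Y)‖ := by
    rw [← intervalIntegral.integral_const_mul]
    exact (intervalIntegral.abs_integral_le_integral_abs h1).trans
      (intervalIntegral.integral_mono_on h1 (Continuous.intervalIntegrable (by fun_prop) _ _)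
        (Continuous.intervalIntegrable (by fun_prop) _ _) fun r _ => n1 r)
  have b2 : |∫ r in (0:ℝ)..ρ, r * fderiv ℝ (fderiv ℝ f) (x + r • Y) Y Y|
      ≤ 4 * ∫ r in (0:ℝ)..ρ, r * ‖fderiv ℝ (fderiv ℝ f) (x + r • Y)‖ := by
    rw [← intervalIntegral.integral_const_mul]
    have c2' : Continuous fun r : ℝ => ‖fderiv ℝ (fderiv ℝ f) (x + r • Y)‖ :=
      (hess_norm_cont hf).comp (by fun_prop : Continuous fun r : ℝ => x + r • Y)
    have c3 : Continuous fun r : ℝ => 4 * (r * ‖fderiv ℝ (fderiv ℝ f) (x + r • Y)‖) :=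
      continuous_const.mul (continuous_id.mul c2')
    refine (intervalIntegral.abs_integral_le_integral_abs h0.le).trans
      (intervalIntegral.integral_mono_on h0.le (Continuous.intervalIntegrable (by fun_prop) _ _)
        (c3.intervalIntegrable _ _) fun r hr => ?_)
    rw [abs_mul, abs_of_nonneg hr.1]
    nlinarith [n2 r, hr.1]
  have b3 : |ρ * fderiv ℝ f (x + ρ • Y) Y| ≤ 2 * ρ * ‖fderiv ℝ f (x + ρ • Y)‖ := by
    rw [abs_mul, abs_of_pos h0]
    nlinarith [n1 ρ]
  have e0 : f x - f (x + (1:ℝ) • Y) = -(∫ r in ρ..1, fderiv ℝ f (x + r • Y) Y)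
      - ρ * fderiv ℝ f (x + ρ • Y) Y
      + ∫ r in (0:ℝ)..ρ, r * fderiv ℝ (fderiv ℝ f) (x + r • Y) Y Y := by
    rw [i1, i2]; simp; ring
  rw [e0, abs_le]
  rw [abs_le] at b1 b2 b3
  constructor <;> linarith [b1.1, b1.2, b2.1, b2.2, b3.1, b3.2]

lemma core {f : Spc → ℝ} (hf : ContDiff ℝ 2 f) (x : Spc) {A B : ℝ}
    (hA : ∀ r : ℝ, 0 < r → r ≤ 1 → ∫ y, ‖fderiv ℝ f (dil x (fun _ => r) y)‖ ∂muQ ≤ A * r ^ (-(3/2) : ℝ))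
    (hB : ∀ r : ℝ, 0 < r → r ≤ 1 →
      ∫ y, ‖fderiv ℝ (fderiv ℝ f) (dil x (fun _ => r) y)‖ ∂muQ ≤ B * r ^ (-(3/2) : ℝ))
    {σ : ℝ} (h0 : 0 < σ) (h1 : σ ≤ 1) :
    |f x - ∫ y, f (dil x 1 y) ∂muQ| ≤ 6 * A / σ + 8 * B * σ := by
  have hf' : ContDiff ℝ 1 (fderiv ℝ f) := hf.fderiv_right (by norm_num)
  have c0 : Continuous f := hf.continuous
  have c1 : Continuous (fderiv ℝ f) := hf'.continuous
  have c2 : Continuous (fderiv ℝ (fderiv ℝ f)) := hf'.continuous_fderiv (by norm_num)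
  have hone : ∀ y, dil x 1 y = x + (1:ℝ) • WithLp.toLp 2 y := fun y => dil_const x 1 y
  simp_rw [dil_const] at hA hB
  simp_rw [hone]
  set ρ : ℝ := σ ^ 2 with hρ
  have hρ0 : 0 < ρ := by positivity
  have hρ1 : ρ ≤ 1 := by rw [hρ]; nlinarith
  have hA0 : 0 ≤ A := by
    have := hA 1 one_pos le_rfl
    simp only [Real.one_rpow, mul_one] at this
    exact (integral_nonneg fun _ => norm_nonneg _).trans this
  have k1 : Continuous (Function.uncurry fun (r : ℝ) (y : Fin 3 → ℝ) =>
      ‖fderiv ℝ f (x + r • WithLp.toLp 2 y)‖) := by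
    simp only [Function.uncurry_def]; fun_prop
  have k2 : Continuous (Function.uncurry fun (r : ℝ) (y : Fin 3 → ℝ) =>
      r * ‖fderiv ℝ (fderiv ℝ f) (x + r • WithLp.toLp 2 y)‖) := by
    simp only [Function.uncurry_def]
    exact continuous_fst.mul ((hess_norm_cont hf).comp
      (by fun_prop : Continuous fun p : ℝ × (Fin 3 → ℝ) => (x + p.1 • WithLp.toLp 2 p.2 : Spc)))
  have j1 : Continuous fun y : Fin 3 → ℝ => ∫ r in ρ..1, ‖fderiv ℝ f (x + r • WithLp.toLp 2 y)‖ :=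
    inner_cont k1 _ _
  have j2 : Continuous fun y : Fin 3 → ℝ => ∫ r in (0:ℝ)..ρ,
      r * ‖fderiv ℝ (fderiv ℝ f) (x + r • WithLp.toLp 2 y)‖ := inner_cont k2 _ _
  have j3 : Continuous fun y : Fin 3 → ℝ => ‖fderiv ℝ f (x + ρ • WithLp.toLp 2 y)‖ := by fun_prop
  have s1 : f x - ∫ y, f (x + (1:ℝ) • WithLp.toLp 2 y) ∂muQ
      = ∫ y, (f x - f (x + (1:ℝ) • WithLp.toLp 2 y)) ∂muQ := by
    rw [integral_sub (integrable_const _) (muQ_integrable (by fun_prop))]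
    simp
  have s2 : |f x - ∫ y, f (x + (1:ℝ) • WithLp.toLp 2 y) ∂muQ| ≤
      2 * (∫ r in ρ..1, ∫ y, ‖fderiv ℝ f (x + r • WithLp.toLp 2 y)‖ ∂muQ)
      + 2 * ρ * (∫ y, ‖fderiv ℝ f (x + ρ • WithLp.toLp 2 y)‖ ∂muQ)
      + 4 * ∫ r in (0:ℝ)..ρ, ∫ y, r * ‖fderiv ℝ (fderiv ℝ f) (x + r • WithLp.toLp 2 y)‖ ∂muQ := by
    rw [s1, ← swap_int k1, ← swap_int k2]
    refine abs_integral_le_integral_abs.trans ?_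
    rw [← integral_const_mul, ← integral_const_mul, ← integral_const_mul,
      ← integral_add (muQ_integrable (by fun_prop)) (muQ_integrable (by fun_prop)),
      ← integral_add (muQ_integrable (by fun_prop)) (muQ_integrable (by fun_prop))]
    refine integral_mono_ae (muQ_integrable (by fun_prop)) (muQ_integrable (by fun_prop)) ?_
    exact ae_Q fun y hy => line_bound hf x _ (Q_norm hy) hρ0 hρ1
  have t1 : ∫ r in ρ..1, ∫ y, ‖fderiv ℝ f (x + r • WithLp.toLp 2 y)‖ ∂muQ ≤ A * (2 / σ) := by
    have hn : (0:ℝ) ∉ uIcc ρ 1 := by rw [uIcc_of_le hρ1]; exact fun h => absurd h.1 (not_le.2 hρ0)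
    calc _ ≤ ∫ r in ρ..1, A * r ^ (-(3/2) : ℝ) := by
          apply intervalIntegral.integral_mono_on hρ1
          · exact (swap_cont k1).intervalIntegrable _ _
          · exact (intervalIntegral.intervalIntegrable_rpow (Or.inr hn)).const_mul A
          · exact fun r hr => hA r (hρ0.trans_le hr.1) hr.2
      _ = A * (2 / σ - 2) := by
          rw [intervalIntegral.integral_const_mul, integral_rpow (Or.inr ⟨by norm_num, hn⟩)]
          congr 1
          have : ρ ^ (-(3/2) + 1 : ℝ) = 1 / σ := by
            rw [hρ, ← Real.rpow_natCast, ← Real.rpow_mul h0.le]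
            norm_num
            exact Real.rpow_neg_one σ
          rw [this]
          norm_num
          ring
      _ ≤ A * (2 / σ) := by gcongr; linarith
  have t2 : ∫ y, ‖fderiv ℝ f (x + ρ • WithLp.toLp 2 y)‖ ∂muQ ≤ A / σ ^ 3 := by
    refine (hA ρ hρ0 hρ1).trans (le_of_eq ?_)
    rw [div_eq_mul_inv]
    congr 1
    rw [hρ, ← Real.rpow_natCast, ← Real.rpow_mul h0.le, ← Real.rpow_natCast, ← Real.rpow_neg h0.le]
    norm_num
  have t3 : ∫ r in (0:ℝ)..ρ, ∫ y, r * ‖fderiv ℝ (fderiv ℝ f) (x + r • WithLp.toLp 2 y)‖ ∂muQ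
      ≤ B * (2 * σ) := by
    calc _ ≤ ∫ r in (0:ℝ)..ρ, B * r ^ (-(1/2) : ℝ) := by
          apply intervalIntegral.integral_mono_on_of_le_Ioo hρ0.le
          · exact (swap_cont k2).intervalIntegrable _ _
          · exact (intervalIntegral.intervalIntegrable_rpow' (by norm_num)).const_mul B
          · intro r hr
            rw [integral_const_mul]
            refine (mul_le_mul_of_nonneg_left (hB r hr.1 (hr.2.le.trans hρ1)) hr.1.le).trans
              (le_of_eq ?_)
            have : r ^ (-(1/2) : ℝ) = r * r ^ (-(3/2) : ℝ) := by
              nth_rewrite 2 [← Real.rpow_one r]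
              rw [← Real.rpow_add hr.1]
              norm_num
            rw [this]; ring
      _ = B * (2 * σ) := by
          rw [intervalIntegral.integral_const_mul, integral_rpow (Or.inl (by norm_num))]
          congr 1
          have : ρ ^ (-(1/2) + 1 : ℝ) = σ := by
            rw [hρ, ← Real.rpow_natCast, ← Real.rpow_mul h0.le]
            norm_num
          rw [this]
          norm_num
          ring
  have t2' : 2 * ρ * (∫ y, ‖fderiv ℝ f (x + ρ • WithLp.toLp 2 y)‖ ∂muQ) ≤ 2 * A / σ := by
    calc _ ≤ 2 * ρ * (A / σ ^ 3) := by gcongr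
      _ = 2 * A / σ := by rw [hρ]; field_simp
  have : 6 * A / σ + 8 * B * σ = 2 * (A * (2 / σ)) + 2 * A / σ + 4 * (B * (2 * σ)) := by ring
  linarith

lemma periodic_fderiv {E : Type*} [NormedAddCommGroup E] [NormedSpace ℝ E] {f : Spc → E}
    (hf : PeriodicTD f) : PeriodicTD (fderiv ℝ f) := by
  intro x
  have h1 : (fun z => f (z + e 1)) = f := funext fun z => (hf z).1
  have h2 : (fun z => f (z + e 2)) = f := funext fun z => (hf z).2
  constructor
  · rw [← fderiv_comp_add_right, h1]
  · rw [← fderiv_comp_add_right, h2]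

lemma scale_bound {E : Type*} [NormedAddCommGroup E] {w : Spc → E}
    (hw : Continuous w) (hp : PeriodicTD w) (hi : IntegrableOn (fun z => ‖w z‖ ^ 2) cell)
    (x : Spc) (r : ℝ) (h0 : 0 < r) (h1 : r ≤ 1) :
    ∫ y, ‖w (dil x (fun _ => r) y)‖ ∂muQ
      ≤ Real.sqrt (∫ z in cell, ‖w z‖ ^ 2) * r ^ (-(3/2) : ℝ) := by
  refine (norm_dil_le (d := fun _ => r) (fun _ => h0) h1 h1 x hw hp hi).trans (le_of_eq ?_)
  rw [mul_comm]
  congr 1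
  rw [Real.sqrt_eq_rpow, ← Real.rpow_neg_one, ← Real.rpow_mul (by positivity),
    show r * r * r = r ^ (3:ℝ) by norm_num; ring, ← Real.rpow_mul h0.le]
  norm_num

lemma dil_add (x t : Spc) (d y : Fin 3 → ℝ) : dil x d y + t = dil (x + t) d y := by
  simp only [dil]; abel

lemma diff_bound {E : Type*} [NormedAddCommGroup E] [NormedSpace ℝ E] [CompleteSpace E]
    {w : Spc → E} (hw : ContDiff ℝ 1 w) (z t : Spc) (ht : ‖t‖ ≤ 2) :
    ‖w z - w (z + t)‖ ≤ 2 * ∫ s in (0:ℝ)..1, ‖fderiv ℝ w (z + s • t)‖ := by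
  have c1 : Continuous (fderiv ℝ w) := hw.continuous_fderiv (by norm_num)
  have hd : Differentiable ℝ w := hw.differentiable (by norm_num)
  have hp : ∀ r : ℝ, HasDerivAt (fun r : ℝ => z + r • t) t r := by
    intro r
    simpa using ((hasDerivAt_id r).smul_const t).const_add z
  have hu : ∀ r : ℝ, HasDerivAt (fun r : ℝ => w (z + r • t)) (fderiv ℝ w (z + r • t) t) r :=
    fun r => (hd _).hasFDerivAt.comp_hasDerivAt r (hp r)
  have cl : Continuous fun r : ℝ => z + r • t := by fun_prop
  have cc : Continuous fun r : ℝ => fderiv ℝ w (z + r • t) t :=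
    (c1.comp cl).clm_apply continuous_const
  have i1 : ∫ r in (0:ℝ)..1, fderiv ℝ w (z + r • t) t = w (z + (1:ℝ) • t) - w (z + (0:ℝ) • t) :=
    intervalIntegral.integral_eq_sub_of_hasDerivAt (fun r _ => hu r) (cc.intervalIntegrable _ _)
  simp only [one_smul, zero_smul, add_zero] at i1
  rw [norm_sub_rev, ← i1, ← intervalIntegral.integral_const_mul]
  refine (intervalIntegral.norm_integral_le_integral_norm zero_le_one).trans
    (intervalIntegral.integral_mono_on zero_le_one (cc.norm.intervalIntegrable _ _)
      ((continuous_const.mul (c1.norm.comp cl)).intervalIntegrable _ _) fun r _ => ?_)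
  have := (fderiv ℝ w (z + r • t)).le_opNorm t
  have h2 := norm_nonneg (fderiv ℝ w (z + r • t))
  nlinarith

lemma transversal {g : Spc → ℝ} (hp : PeriodicTD g) (hg : ContDiff ℝ 2 g)
    (hi1 : IntegrableOn (fun z => ‖fderiv ℝ g z‖ ^ 2) cell)
    (hi2 : IntegrableOn (fun z => ‖fderiv ℝ (fderiv ℝ g) z‖ ^ 2) cell)
    (x t : Spc) (ht0 : t 0 = 0) (ht : ‖t‖ ≤ 2) :
    |g x - g (x + t)| ≤ 28 * (Real.sqrt (Real.sqrt (∫ z in cell, ‖fderiv ℝ g z‖ ^ 2))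
      * Real.sqrt (Real.sqrt (∫ z in cell, ‖fderiv ℝ (fderiv ℝ g) z‖ ^ 2))) := by
  have hg' : ContDiff ℝ 1 (fderiv ℝ g) := hg.fderiv_right (by norm_num)
  have c1 : Continuous (fderiv ℝ g) := hg'.continuous
  have c2 : Continuous (fderiv ℝ (fderiv ℝ g)) := hg'.continuous_fderiv (by norm_num)
  have hd1 : Differentiable ℝ g := hg.differentiable (by norm_num)
  have hd2 : Differentiable ℝ (fderiv ℝ g) := hg'.differentiable (by norm_num)
  have p1 := periodic_fderiv hp
  have p2 := periodic_fderiv p1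
  have S1 := scale_bound c1 p1 hi1
  have S2 := scale_bound c2 p2 hi2
  set a := Real.sqrt (∫ z in cell, ‖fderiv ℝ g z‖ ^ 2)
  set b := Real.sqrt (∫ z in cell, ‖fderiv ℝ (fderiv ℝ g) z‖ ^ 2)
  have ha : 0 ≤ a := Real.sqrt_nonneg _
  have hb : 0 ≤ b := Real.sqrt_nonneg _
  set h : Spc → ℝ := fun z => g z - g (z + t) with hh
  have hcd : ContDiff ℝ 2 h := hg.sub (hg.comp (contDiff_id.add contDiff_const))
  have hD : ∀ z, fderiv ℝ h z = fderiv ℝ g z - fderiv ℝ g (z + t) := by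
    intro z
    have d2 : DifferentiableAt ℝ (fun z => g (z + t)) z :=
      (hd1.comp (differentiable_id.add (differentiable_const t))) z
    rw [hh, fderiv_fun_sub (hd1 z) d2, fderiv_comp_add_right]
  have hD' : fderiv ℝ h = fun z => fderiv ℝ g z - fderiv ℝ g (z + t) := funext hD
  have hDD : ∀ z, fderiv ℝ (fderiv ℝ h) z
      = fderiv ℝ (fderiv ℝ g) z - fderiv ℝ (fderiv ℝ g) (z + t) := by
    intro z
    have d2 : DifferentiableAt ℝ (fun z => fderiv ℝ g (z + t)) z :=
      (hd2.comp (differentiable_id.add (differentiable_const t))) z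
    rw [hD', fderiv_fun_sub (hd2 z) d2, fderiv_comp_add_right]
  have dc : ∀ (x : Spc) (r : ℝ), Continuous (dil x fun _ => r) := fun x r => dil_cont x _
  have two : ∀ {E : Type} [NormedAddCommGroup E] (w : Spc → E), Continuous w → ∀ (r : ℝ),
      ∫ y, ‖w (dil x (fun _ => r) y) - w (dil x (fun _ => r) y + t)‖ ∂muQ
      ≤ (∫ y, ‖w (dil x (fun _ => r) y)‖ ∂muQ) + ∫ y, ‖w (dil (x + t) (fun _ => r) y)‖ ∂muQ := by
    intro E _ w hw r
    have q1 : Continuous fun y => w (dil x (fun _ => r) y) := hw.comp (dc x r)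
    have q2 : Continuous fun y => w (dil (x + t) (fun _ => r) y) := hw.comp (dc (x + t) r)
    simp_rw [dil_add]
    rw [← integral_add (muQ_integrable q1.norm) (muQ_integrable q2.norm)]
    exact integral_mono (muQ_integrable (q1.sub q2).norm)
      ((muQ_integrable q1.norm).add (muQ_integrable q2.norm)) fun y => norm_sub_le _ _
  have A1 : ∀ r : ℝ, 0 < r → r ≤ 1 →
      ∫ y, ‖fderiv ℝ h (dil x (fun _ => r) y)‖ ∂muQ ≤ 2 * a * r ^ (-(3/2) : ℝ) := by
    intro r h0 h1
    simp_rw [hD]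
    linarith [two _ c1 r, S1 x r h0 h1, S1 (x + t) r h0 h1]
  have A2 : ∀ r : ℝ, 0 < r → r ≤ 1 →
      ∫ y, ‖fderiv ℝ h (dil x (fun _ => r) y)‖ ∂muQ ≤ 2 * b * r ^ (-(3/2) : ℝ) := by
    intro r h0 h1
    simp_rw [hD]
    have k : Continuous (Function.uncurry fun (s : ℝ) (y : Fin 3 → ℝ) =>
        ‖fderiv ℝ (fderiv ℝ g) (dil x (fun _ => r) y + s • t)‖) := by
      have : Continuous fun p : ℝ × (Fin 3 → ℝ) => dil x (fun _ => r) p.2 + p.1 • t :=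
        ((dc x r).comp continuous_snd).add (by fun_prop)
      exact (hess_norm_cont hg).comp this
    have q1 : Continuous fun y => fderiv ℝ g (dil x (fun _ => r) y) := c1.comp (dc x r)
    have q2 : Continuous fun y => fderiv ℝ g (dil x (fun _ => r) y + t) :=
      c1.comp ((dc x r).add continuous_const)
    calc _ ≤ ∫ y, 2 * (∫ s in (0:ℝ)..1,
            ‖fderiv ℝ (fderiv ℝ g) (dil x (fun _ => r) y + s • t)‖) ∂muQ :=
          integral_mono (muQ_integrable (q1.sub q2).norm)
            (muQ_integrable (continuous_const.mul (inner_cont k 0 1)))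
            fun y => diff_bound hg' _ t ht
      _ = 2 * ∫ s in (0:ℝ)..1, ∫ y,
            ‖fderiv ℝ (fderiv ℝ g) (dil x (fun _ => r) y + s • t)‖ ∂muQ := by
          rw [integral_const_mul, swap_int k]
      _ ≤ 2 * ∫ s in (0:ℝ)..1, b * r ^ (-(3/2) : ℝ) := by
          refine mul_le_mul_of_nonneg_left ?_ (by norm_num)
          refine intervalIntegral.integral_mono_on zero_le_one
            ((swap_cont k).intervalIntegrable _ _) (by simp) fun s _ => ?_
          simp_rw [dil_add]
          exact S2 _ r h0 h1
      _ = _ := by simp; ring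
  have A3 : ∀ r : ℝ, 0 < r → r ≤ 1 →
      ∫ y, ‖fderiv ℝ h (dil x (fun _ => r) y)‖ ∂muQ ≤ 2 * min a b * r ^ (-(3/2) : ℝ) := by
    intro r h0 h1
    rcases min_choice a b with h | h <;> rw [h]
    · exact A1 r h0 h1
    · exact A2 r h0 h1
  have B1 : ∀ r : ℝ, 0 < r → r ≤ 1 →
      ∫ y, ‖fderiv ℝ (fderiv ℝ h) (dil x (fun _ => r) y)‖ ∂muQ ≤ 2 * b * r ^ (-(3/2) : ℝ) := by
    intro r h0 h1
    simp_rw [hDD]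
    linarith [two (E := Spc →L[ℝ] Spc →L[ℝ] ℝ) _ c2 r, S2 x r h0 h1, S2 (x + t) r h0 h1]
  have havg : ∫ y, h (dil x 1 y) ∂muQ = 0 := by
    have q1 : Continuous fun y => g (dil x 1 y) := hg.continuous.comp (dil_cont x 1)
    have q2 : Continuous fun y => g (dil (x + t) 1 y) := hg.continuous.comp (dil_cont (x + t) 1)
    simp_rw [hh, dil_add]
    rw [integral_sub (muQ_integrable q1) (muQ_integrable q2), avg_shift hg.continuous hp x t ht0,
      sub_self]
  have hm : 0 ≤ min a b := le_min ha hb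
  have fin : |h x| ≤ (12 + 16) * (Real.sqrt (min a b) * Real.sqrt b) := by
    refine opt hm hb (fun σ h0 h1 => ?_) (by norm_num) (by norm_num)
    have := core hcd x A3 B1 h0 (h1 (min_le_right _ _))
    rw [havg, sub_zero] at this
    refine this.trans (le_of_eq ?_)
    ring
  refine fin.trans ?_
  norm_num
  gcongr
  exact min_le_left _ _

/-- The dilation vector acting on the first coordinate only. -/
def vR (R : ℝ) : Fin 3 → ℝ := ![R, 1, 1]

lemma dil_vR (x : Spc) (R : ℝ) (y : Fin 3 → ℝ) :
    dil x (vR R) y = dil x (vR 0) y + R • (y 0 • e 0) := by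
  ext i
  fin_cases i <;> simp [dil, vR, e]

lemma longitudinal {g : Spc → ℝ} (hp : PeriodicTD g) (hg : ContDiff ℝ 2 g)
    (hi0 : IntegrableOn (fun z => ‖g z‖ ^ 2) cell)
    (hi1 : IntegrableOn (fun z => ‖fderiv ℝ g z (e 0)‖ ^ 2) cell) (x : Spc) :
    |∫ y, g (dil x (vR 0) y) ∂muQ| ≤ 3 * (Real.sqrt (Real.sqrt (∫ z in cell, ‖g z‖ ^ 2))
      * Real.sqrt (Real.sqrt (∫ z in cell, ‖fderiv ℝ g z (e 0)‖ ^ 2))) := by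
  have hd1 : Differentiable ℝ g := hg.differentiable (by norm_num)
  have c0 := hg.continuous
  have cD : Continuous (fderiv ℝ g) := hg.continuous_fderiv (by norm_num)
  have c1 : Continuous fun z => fderiv ℝ g z (e 0) := cD.clm_apply continuous_const
  have p1 : PeriodicTD fun z => fderiv ℝ g z (e 0) := by
    intro z
    simp only [(periodic_fderiv hp z).1, (periodic_fderiv hp z).2, and_self]
  have hN : ∀ {w : Spc → ℝ}, Continuous w → PeriodicTD w →
      IntegrableOn (fun z => ‖w z‖ ^ 2) cell → ∀ R : ℝ, 0 < R →
      ∫ y, ‖w (dil x (vR R) y)‖ ∂muQ ≤ Real.sqrt R⁻¹ * Real.sqrt (∫ z in cell, ‖w z‖ ^ 2) := by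
    intro w hw hpw hiw R hR
    have := norm_dil_le (d := vR R) (by intro i; fin_cases i <;> simp [vR, hR]) (by simp [vR])
      (by simp [vR]) x hw hpw hiw
    simpa [vR] using this
  have S0 := hN c0 hp hi0
  have S1 := hN c1 p1 hi1
  set α := Real.sqrt (∫ z in cell, ‖g z‖ ^ 2)
  set β := Real.sqrt (∫ z in cell, ‖fderiv ℝ g z (e 0)‖ ^ 2)
  rw [show (3:ℝ) = 1 + 2 by norm_num]
  refine opt (Real.sqrt_nonneg _) (Real.sqrt_nonneg _) (fun σ hσ _ => ?_) (by norm_num) (by norm_num)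
  have hL : 0 < σ ^ 2 := by positivity
  have dc : Continuous fun p : ℝ × (Fin 3 → ℝ) => dil x (vR p.1) p.2 := by
    have : (fun p : ℝ × (Fin 3 → ℝ) => dil x (vR p.1) p.2)
        = fun p => dil x (vR 0) p.2 + p.1 • (p.2 0 • e 0) := funext fun p => dil_vR x p.1 p.2
    rw [this]
    exact ((dil_cont x (vR 0)).comp continuous_snd).add (by fun_prop)
  have k : Continuous (Function.uncurry fun (R : ℝ) (y : Fin 3 → ℝ) =>
      ‖fderiv ℝ g (dil x (vR R) y) (e 0)‖) := c1.norm.comp dc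
  have dR : ∀ R, Continuous (dil x (vR R)) := fun R => dil_cont _ _
  have line : ∀ y ∈ Q, |g (dil x (vR 0) y)| ≤ ‖g (dil x (vR (σ ^ 2)) y)‖
      + ∫ R in (0:ℝ)..(σ ^ 2), ‖fderiv ℝ g (dil x (vR R) y) (e 0)‖ := by
    intro y hy
    have hy0 := hy 0 (mem_univ 0)
    have hu : ∀ R : ℝ, HasDerivAt (fun R : ℝ => g (dil x (vR R) y))
        (y 0 * fderiv ℝ g (dil x (vR R) y) (e 0)) R := by
      intro R
      have hpd : HasDerivAt (fun R : ℝ => dil x (vR R) y) (y 0 • e 0) R := by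
        rw [show (fun R : ℝ => dil x (vR R) y) = fun R => dil x (vR 0) y + R • (y 0 • e 0) from
          funext fun R => dil_vR x R y]
        simpa using ((hasDerivAt_id R).smul_const (y 0 • e 0)).const_add (dil x (vR 0) y)
      have := (hd1 (dil x (vR R) y)).hasFDerivAt.comp_hasDerivAt R hpd
      rw [map_smul, smul_eq_mul] at this
      exact this
    have cy : Continuous fun R : ℝ => fderiv ℝ g (dil x (vR R) y) (e 0) :=
      c1.comp (dc.comp (by fun_prop : Continuous fun R : ℝ => (R, y)))
    have i1 : ∫ R in (0:ℝ)..(σ ^ 2), y 0 * fderiv ℝ g (dil x (vR R) y) (e 0)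
        = g (dil x (vR (σ ^ 2)) y) - g (dil x (vR 0) y) :=
      intervalIntegral.integral_eq_sub_of_hasDerivAt (fun r _ => hu r)
        ((continuous_const.mul cy).intervalIntegrable _ _)
    have b1 : |∫ R in (0:ℝ)..(σ ^ 2), y 0 * fderiv ℝ g (dil x (vR R) y) (e 0)|
        ≤ ∫ R in (0:ℝ)..(σ ^ 2), ‖fderiv ℝ g (dil x (vR R) y) (e 0)‖ := by
      refine (intervalIntegral.abs_integral_le_integral_abs hL.le).trans
        (intervalIntegral.integral_mono_on hL.le
          ((continuous_const.mul cy).abs.intervalIntegrable _ _)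
          (cy.norm.intervalIntegrable _ _) fun R _ => ?_)
      rw [abs_mul, abs_of_pos hy0.1, Real.norm_eq_abs]
      exact mul_le_of_le_one_left (abs_nonneg _) hy0.2
    rw [i1] at b1
    rw [Real.norm_eq_abs]
    have := abs_sub_abs_le_abs_sub (g (dil x (vR 0) y)) (g (dil x (vR (σ ^ 2)) y))
    rw [abs_sub_comm] at this
    linarith
  have q0 : Continuous fun y => |g (dil x (vR 0) y)| := (c0.comp (dR 0)).abs
  have q1 : Continuous fun y => ‖g (dil x (vR (σ ^ 2)) y)‖ := (c0.comp (dR (σ ^ 2))).norm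
  have q2 := inner_cont k 0 (σ ^ 2)
  have m1 : |∫ y, g (dil x (vR 0) y) ∂muQ| ≤ (∫ y, ‖g (dil x (vR (σ ^ 2)) y)‖ ∂muQ)
      + ∫ R in (0:ℝ)..(σ ^ 2), ∫ y, ‖fderiv ℝ g (dil x (vR R) y) (e 0)‖ ∂muQ := by
    refine abs_integral_le_integral_abs.trans ?_
    rw [← swap_int k, ← integral_add (muQ_integrable q1) (muQ_integrable q2)]
    exact integral_mono_ae (muQ_integrable q0) ((muQ_integrable q1).add (muQ_integrable q2))
      (ae_Q line)
  have m2 : ∫ y, ‖g (dil x (vR (σ ^ 2)) y)‖ ∂muQ ≤ 1 * α / σ := by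
    refine (S0 _ hL).trans (le_of_eq ?_)
    rw [Real.sqrt_inv, Real.sqrt_sq hσ.le]
    ring
  have m3 : ∫ R in (0:ℝ)..(σ ^ 2), ∫ y, ‖fderiv ℝ g (dil x (vR R) y) (e 0)‖ ∂muQ ≤ 2 * β * σ := by
    calc _ ≤ ∫ R in (0:ℝ)..(σ ^ 2), β * R ^ (-(1/2) : ℝ) := by
          apply intervalIntegral.integral_mono_on_of_le_Ioo hL.le
          · exact (swap_cont k).intervalIntegrable _ _
          · exact (intervalIntegral.intervalIntegrable_rpow' (by norm_num)).const_mul β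
          · intro r hr
            refine (S1 r hr.1).trans (le_of_eq ?_)
            rw [mul_comm, Real.sqrt_inv, Real.sqrt_eq_rpow, ← Real.rpow_neg hr.1.le]
      _ = _ := by
          rw [intervalIntegral.integral_const_mul, integral_rpow (Or.inl (by norm_num))]
          have : (σ ^ 2) ^ (-(1/2) + 1 : ℝ) = σ := by
            rw [← Real.rpow_natCast, ← Real.rpow_mul hσ.le]
            norm_num
          rw [this]
          norm_num
          ring
  linarith


/-- Lemma 3.5, Gagliardo–Nirenberg type interpolation on `Ω = ℝ × 𝕋²`:
`‖g‖_{L^∞} ≤ C ‖g‖_{L²}^{1/2} ‖∂₁ g‖_{L²}^{1/2} + C ‖∇g‖_{L²}^{1/2} ‖∇²g‖_{L²}^{1/2}`.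
Functions on `Ω` are modelled as functions on `ℝ³` that are periodic in the transversal
directions; a `g ∈ H²(Ω)` is represented by its (continuous) `C²` representative with
finite `H²` norm, and the `L^∞` bound is the pointwise bound. -/
theorem interpolation_inequality_Linfty :
    ∃ C > 0, ∀ g : Spc → ℝ,
      PeriodicTD g → ContDiff ℝ 2 g → MemH 2 g →
      ∀ x : Spc,
        |g x| ≤ C * Real.sqrt (L2 cell g)
                  * Real.sqrt (L2 cell (fun y => fderiv ℝ g y (e 0)))
              + C * Real.sqrt (Real.sqrt (DSq 1 g)) * Real.sqrt (Real.sqrt (DSq 2 g)) := by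
  refine ⟨28, by norm_num, fun g hp hg hH x => ?_⟩
  have cD : Continuous (fderiv ℝ g) := hg.continuous_fderiv (by norm_num)
  have n1 : ∀ z, ‖iteratedFDeriv ℝ 1 g z‖ = ‖fderiv ℝ g z‖ := fun z => norm_iteratedFDeriv_one g
  have n2 : ∀ z, ‖iteratedFDeriv ℝ 2 g z‖ = ‖fderiv ℝ (fderiv ℝ g) z‖ := fun z => by
    rw [← norm_iteratedFDeriv_fderiv, norm_iteratedFDeriv_one]
  have hi0 : IntegrableOn (fun z => ‖g z‖ ^ 2) cell := by
    have := hH 0 (by norm_num)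
    simpa [MemDSq] using this
  have hi1 : IntegrableOn (fun z => ‖fderiv ℝ g z‖ ^ 2) cell := by
    have := hH 1 (by norm_num)
    simpa only [MemDSq, n1] using this
  have hi2 : IntegrableOn (fun z => ‖fderiv ℝ (fderiv ℝ g) z‖ ^ 2) cell := by
    have := hH 2 (by norm_num)
    simpa only [MemDSq, n2] using this
  have hi1' : IntegrableOn (fun z => ‖fderiv ℝ g z (e 0)‖ ^ 2) cell := by
    have c1 : Continuous fun z => fderiv ℝ g z (e 0) := cD.clm_apply continuous_const
    refine Integrable.mono' hi1 (c1.norm.pow 2).aestronglyMeasurable (ae_of_all _ fun z => ?_)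
    rw [Real.norm_eq_abs, abs_of_nonneg (by positivity)]
    have := (fderiv ℝ g z).le_opNorm (e 0)
    have he : ‖e 0‖ = 1 := by simp [e]
    rw [he, mul_one] at this
    gcongr
  have hT := transversal hp hg hi1 hi2 x
  have hLn := longitudinal hp hg hi0 hi1' x
  simp only [L2, L2Sq, DSq, n1, n2]
  set K := 28 * (Real.sqrt (Real.sqrt (∫ z in cell, ‖fderiv ℝ g z‖ ^ 2))
      * Real.sqrt (Real.sqrt (∫ z in cell, ‖fderiv ℝ (fderiv ℝ g) z‖ ^ 2))) with hK
  set M := Real.sqrt (Real.sqrt (∫ z in cell, ‖g z‖ ^ 2))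
      * Real.sqrt (Real.sqrt (∫ z in cell, ‖fderiv ℝ g z (e 0)‖ ^ 2)) with hM
  have hM0 : 0 ≤ M := by positivity
  have c : Continuous fun y => g (dil x (vR 0) y) := hg.continuous.comp (dil_cont x (vR 0))
  have h1 : |∫ y, (g x - g (dil x (vR 0) y)) ∂muQ| ≤ K := by
    have : ∀ᵐ y ∂muQ, ‖g x - g (dil x (vR 0) y)‖ ≤ K := by
      refine ae_Q fun y hy => ?_
      refine hT (WithLp.toLp 2 (vR 0 * y)) (by simp [vR]) ?_
      refine le_trans ?_ (Q_norm hy)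
      rw [EuclideanSpace.norm_eq, EuclideanSpace.norm_eq]
      apply Real.sqrt_le_sqrt
      simp only [Fin.sum_univ_three, vR]
      simp
      positivity
    simpa using norm_integral_le_of_norm_le_const this
  rw [integral_sub (integrable_const _) (muQ_integrable c)] at h1
  simp only [integral_const, probReal_univ, one_smul] at h1
  have h2 := abs_sub_abs_le_abs_sub (g x) (∫ y, g (dil x (vR 0) y) ∂muQ)
  rw [mul_assoc, mul_assoc, ← hK, ← hM]
  linarith

end NS3D
end
end

section
/- There exist positive constants δ₀, ε₁, C (depending only on (v₊,u₊)) such that the following holds. Suppose δ₁, δ₂ < δ₀, suppose v : [0,T] × Ω → ℝ satisfies v₊/2 ≤ v ≤ 2v₊ and ‖v − ṽ‖_{L^∞((0,T)×Ω)} ≤ Cε₁, and suppose (X₁,X₂) is a Lipschitz solution of the shift ODE system on [0,T]. Then for each i = 1,2 and all t ≤ T, |Ẋᵢ(t)| ≤ C‖(v − ṽ)(t,·)‖_{L^∞(Ω)}. -/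
noncomputable section
open MeasureTheory Set Filter Topology Real

namespace NS3D

variable {F : Type*} [NormedAddCommGroup F] [NormedSpace ℝ F]

lemma mono_int (q q' : ℝ → ℝ) (a b : ℝ) (hd : ∀ x, HasDerivAt q (q' x) x) (hc : Continuous q')
    (hp : ∀ x, 0 ≤ q' x) (ha : Tendsto q atBot (𝓝 a)) (hb : Tendsto q atTop (𝓝 b)) :
    Integrable (fun x => |q' x|) ∧ ∫ x, |q' x| = b - a := by
  have e1 : (fun x => |q' x|) = q' := by funext x; exact abs_of_nonneg (hp x)
  rw [e1]
  have hI : Integrable q' := by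
    refine integrable_of_intervalIntegral_norm_tendsto (l := atTop) (b - a)
      (a := fun t : ℝ => -t) (b := fun t : ℝ => t)
      (fun i => (hc.integrableOn_Icc).mono_set Ioc_subset_Icc_self) tendsto_neg_atTop_atBot
      tendsto_id ?_
    have : (fun i : ℝ => ∫ x in (-i)..i, ‖q' x‖) = fun i => q i - q (-i) := by
      funext i
      have e2 : ∀ x, ‖q' x‖ = q' x := fun x => abs_of_nonneg (hp x)
      simp only [e2]
      exact intervalIntegral.integral_eq_sub_of_hasDerivAt (fun x _ => hd x)
        (hc.intervalIntegrable _ _)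
    rw [this]
    exact hb.sub (ha.comp tendsto_neg_atTop_atBot)
  exact ⟨hI, integral_of_hasDerivAt_of_tendsto hd hI ha hb⟩

lemma mono_int' (q q' : ℝ → ℝ) (a b s : ℝ) (hs : s ≠ 0) (hd : ∀ x, HasDerivAt q (q' x) x)
    (hc : Continuous q')
    (hp : ∀ x, 0 ≤ s * q' x) (ha : Tendsto q atBot (𝓝 a)) (hb : Tendsto q atTop (𝓝 b)) :
    Integrable (fun x => |q' x|) ∧ ∫ x, |q' x| ≤ |b - a| := by
  rcases lt_or_gt_of_ne hs with h | h
  · have h1 : ∀ x, 0 ≤ - q' x := fun x => by nlinarith [hp x]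
    have := mono_int (fun x => - q x) (fun x => - q' x) (-a) (-b) (fun x => (hd x).neg) hc.neg h1
      ha.neg hb.neg
    simp only [abs_neg] at this
    refine ⟨this.1, this.2.le.trans ?_⟩
    rw [abs_sub_comm]
    exact le_trans (by linarith) (le_abs_self _)
  · have h1 : ∀ x, 0 ≤ q' x := fun x => by
      by_contra hn
      push Not at hn
      nlinarith [hp x]
    have := mono_int q q' a b hd hc h1 ha hb
    exact ⟨this.1, this.2.le.trans (le_abs_self _)⟩

lemma mp_cell : MeasurePreserving (fun x : Spc => x 0) (volume.restrict cell) volume := by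
  have h1 := (volume_preserving_piFinSuccAbove (fun _ : Fin 3 => ℝ) 0).comp
    (PiLp.volume_preserving_ofLp (Fin 3))
  have hs : MeasurableSet ((univ : Set ℝ) ×ˢ (Icc (0 : Fin 2 → ℝ) 1)) :=
    MeasurableSet.univ.prod measurableSet_Icc
  have h2 := h1.restrict_preimage hs
  have hcell : cell = (⇑(MeasurableEquiv.piFinSuccAbove (fun _ : Fin 3 => ℝ) 0) ∘ WithLp.ofLp) ⁻¹'
      ((univ : Set ℝ) ×ˢ (Icc (0 : Fin 2 → ℝ) 1)) := by
    ext x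
    simp only [cell, mem_ofPred_eq, mem_preimage, Function.comp, mem_prod, mem_univ, true_and, mem_Icc,
      Pi.le_def, Fin.forall_fin_two]
    have e1 : ((MeasurableEquiv.piFinSuccAbove (fun _ : Fin 3 => ℝ) 0) x.ofLp).2 0 = x 1 := rfl
    have e2 : ((MeasurableEquiv.piFinSuccAbove (fun _ : Fin 3 => ℝ) 0) x.ofLp).2 1 = x 2 := rfl
    rw [e1, e2]
    simp only [Pi.zero_apply, Pi.one_apply]
    tauto
  rw [← hcell] at h2
  have h3 : (volume : Measure (ℝ × (Fin 2 → ℝ))).restrict ((univ : Set ℝ) ×ˢ (Icc (0 : Fin 2 → ℝ) 1))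
      = (volume : Measure ℝ).prod ((volume : Measure (Fin 2 → ℝ)).restrict (Icc 0 1)) := by
    rw [Measure.volume_eq_prod, ← Measure.prod_restrict, Measure.restrict_univ]
  have hprob : IsProbabilityMeasure ((volume : Measure (Fin 2 → ℝ)).restrict (Icc 0 1)) := by
    constructor
    simp [Real.volume_Icc_pi]
  have h4 : MeasurePreserving (Prod.fst : ℝ × (Fin 2 → ℝ) → ℝ)
      ((volume : Measure ℝ).prod ((volume : Measure (Fin 2 → ℝ)).restrict (Icc 0 1))) volume :=
    measurePreserving_fst
  have h5 : MeasurePreserving (⇑(MeasurableEquiv.piFinSuccAbove (fun _ : Fin 3 => ℝ) 0) ∘ WithLp.ofLp)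
      (volume.restrict cell)
      ((volume : Measure ℝ).prod ((volume : Measure (Fin 2 → ℝ)).restrict (Icc 0 1))) := by
    rw [← h3]; exact h2
  exact h4.comp h5

lemma pfn_hasDeriv (γ v : ℝ) (hv : 0 < v) : HasDerivAt (pfn γ) (pderivfn γ v) v := by
  have := Real.hasDerivAt_rpow_const (x := v) (p := -γ) (Or.inl hv.ne')
  exact this

lemma pfn_anti (γ : ℝ) (hγ : 1 < γ) {a b : ℝ} (ha : 0 < a) (hab : a ≤ b) : pfn γ b ≤ pfn γ a :=
  Real.rpow_le_rpow_of_nonpos ha hab (by linarith)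

/-- slopes of the pressure -/
lemma pfn_slope (γ : ℝ) (hγ : 1 < γ) {l u a b : ℝ} (hl : 0 < l) (hla : l ≤ a) (hab : a < b)
    (hbu : b ≤ u) :
    γ * u ^ (-γ - 1) * (b - a) ≤ pfn γ a - pfn γ b ∧
    pfn γ a - pfn γ b ≤ γ * l ^ (-γ - 1) * (b - a) := by
  obtain ⟨c, hc, h⟩ := exists_hasDerivAt_eq_slope (pfn γ) (pderivfn γ) hab
    (fun x hx => (pfn_hasDeriv γ x (by linarith [hx.1])).continuousAt.continuousWithinAt)
    (fun x hx => pfn_hasDeriv γ x (by linarith [hx.1]))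
  have hba : 0 < b - a := by linarith
  rw [eq_div_iff hba.ne', pderivfn] at h
  have c0 : 0 < c := by linarith [hc.1]
  have i1 : u ^ (-γ - 1) ≤ c ^ (-γ - 1) :=
    Real.rpow_le_rpow_of_nonpos c0 (by linarith [hc.2]) (by linarith)
  have i2 : c ^ (-γ - 1) ≤ l ^ (-γ - 1) :=
    Real.rpow_le_rpow_of_nonpos hl (by linarith [hc.1]) (by linarith)
  have g0 : 0 < γ * (b - a) := by positivity
  constructor <;> nlinarith

lemma pfn_lip (γ : ℝ) (hγ : 1 < γ) {l a b : ℝ} (hl : 0 < l) (hla : l ≤ a) (hlb : l ≤ b) :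
    |pfn γ a - pfn γ b| ≤ γ * l ^ (-γ - 1) * |a - b| := by
  rcases lt_trichotomy a b with h | h | h
  · have := (pfn_slope γ hγ hl hla h le_rfl).2
    have h2 := pfn_anti γ hγ (by linarith) h.le
    rw [abs_of_nonneg (by linarith), abs_of_neg (by linarith)]
    linarith
  · simp [h]
  · have := (pfn_slope γ hγ hl hlb h le_rfl).2
    have h2 := pfn_anti γ hγ (by linarith) h.le
    rw [abs_of_nonpos (by linarith), abs_of_pos (by linarith)]
    linarith

lemma G_convex (γ k : ℝ) (hγ : 1 < γ) :
    StrictConvexOn ℝ (Ioi 0) (fun w => k * w + pfn γ w) := by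
  have hd : ∀ w ∈ Ioi (0:ℝ), HasDerivAt (fun w => k * w + pfn γ w) (k + pderivfn γ w) w := by
    intro w hw
    have := ((hasDerivAt_id w).const_mul k).add (pfn_hasDeriv γ w hw)
    rw [mul_one] at this
    exact this
  refine StrictMonoOn.strictConvexOn_of_deriv (convex_Ioi 0)
    (fun w hw => (hd w hw).continuousAt.continuousWithinAt) ?_
  rw [interior_Ioi]
  intro a ha b hb hab
  rw [(hd a ha).deriv, (hd b hb).deriv]
  have : b ^ (-γ - 1) < a ^ (-γ - 1) := Real.rpow_lt_rpow_of_neg ha hab (by linarith)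
  unfold pderivfn
  nlinarith

lemma G_in {γ k : ℝ} (hγ : 1 < γ) {a b w : ℝ} (ha : 0 < a) (haw : a ≤ w) (hwb : w ≤ b)
    (hG : k * a + pfn γ a = k * b + pfn γ b) : k * w + pfn γ w ≤ k * a + pfn γ a := by
  have := (G_convex γ k hγ).convexOn.le_max_of_mem_Icc (x := a) (y := b) (z := w) ha
    (lt_of_lt_of_le ha (haw.trans hwb)) ⟨haw, hwb⟩
  simpa [← hG] using this

lemma G_out {γ k : ℝ} (hγ : 1 < γ) {x y z : ℝ} (hx : 0 < x) (hxy : x < y) (hyz : y < z) :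
    k * y + pfn γ y < max (k * x + pfn γ x) (k * z + pfn γ z) :=
  (G_convex γ k hγ).lt_on_openSegment (x := x) (y := z) hx (hx.trans (hxy.trans hyz))
    (hxy.trans hyz).ne (by rw [openSegment_eq_Ioo (hxy.trans hyz)]; exact ⟨hxy, hyz⟩)

lemma lim_deriv_zero (v v' : ℝ → ℝ) (a L : ℝ) (hd : ∀ x, HasDerivAt v (v' x) x)
    (hv : Tendsto v atBot (𝓝 a)) (hL : Tendsto v' atBot (𝓝 L)) : L = 0 := by
  have h : ∀ x : ℝ, ∃ c, c ≤ x ∧ v' c = v x - v (x - 1) := by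
    intro x
    obtain ⟨c, hc, h⟩ := exists_hasDerivAt_eq_slope v v' (show x - 1 < x by linarith)
      (fun y _ => (hd y).continuousAt.continuousWithinAt) (fun y _ => hd y)
    exact ⟨c, hc.2.le, by rw [h]; simp⟩
  choose c hc h using h
  have h1 : Tendsto c atBot atBot := tendsto_atBot_mono hc tendsto_id
  have h2 := hL.comp h1
  have h3 : Tendsto (fun x : ℝ => v x - v (x - 1)) atBot (𝓝 (a - a)) :=
    hv.sub (hv.comp (tendsto_atBot_add_const_right atBot (-1 : ℝ) tendsto_id))
  have h4 : (v' ∘ c) = fun x => v x - v (x - 1) := funext h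
  rw [h4] at h2
  simpa using tendsto_nhds_unique h2 h3

lemma exists_max_of_lims (v : ℝ → ℝ) (a b x0 : ℝ) (hc : Continuous v)
    (ha : Tendsto v atBot (𝓝 a)) (hb : Tendsto v atTop (𝓝 b)) (h1 : a < v x0) (h2 : b < v x0) :
    ∃ x, ∀ y, v y ≤ v x := by
  refine hc.exists_forall_ge' x0 ?_
  rw [cocompact_eq_atBot_atTop, eventually_sup]
  exact ⟨(ha.eventually_lt_const h1).mono fun _ h => h.le,
    (hb.eventually_lt_const h2).mono fun _ h => h.le⟩

/-- structure of the viscous shock profile -/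
lemma shock_props {γ μ lam σ vL uL vR uR : ℝ} {vt ut : ℝ → ℝ} (hγ : 1 < γ)
    (hk : 0 < 2 * μ + lam) (hσ : σ ≠ 0) (hvL : 0 < vL) (hvR : 0 < vR) (hne : vL ≠ vR)
    (hRH : σ ^ 2 * vL + pfn γ vL = σ ^ 2 * vR + pfn γ vR)
    (hS : ViscousShock γ μ lam σ vL uL vR uR vt ut) :
    (∀ ξ, min vL vR ≤ vt ξ ∧ vt ξ ≤ max vL vR) ∧
    (∀ ξ, deriv (heff μ lam vt ut) ξ = deriv (fun y => pfn γ (vt y)) ξ / σ) ∧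
    Integrable (fun ξ => |deriv (fun y => pfn γ (vt y)) ξ|) ∧
    ∫ ξ, |deriv (fun y => pfn γ (vt y)) ξ| ≤ |pfn γ vR - pfn γ vL| := by
  obtain ⟨sv, su, pos, ode1, ode2, lLv, lLu, lRv, lRu⟩ := hS
  have dv : ∀ x, HasDerivAt vt (deriv vt x) x := fun x =>
    (sv.differentiable (by norm_num) x).hasDerivAt
  have du : ∀ x, HasDerivAt ut (deriv ut x) x := fun x =>
    (su.differentiable (by norm_num) x).hasDerivAt
  have sv2 : ContDiff ℝ 2 (deriv vt) := by
    have : ContDiff ℝ (2 + 1) vt := by convert sv using 1; norm_num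
    exact (contDiff_succ_iff_deriv.1 this).2.2
  have ddv : ∀ x, HasDerivAt (deriv vt) (deriv (deriv vt) x) x := fun x =>
    (sv2.differentiable (by norm_num) x).hasDerivAt
  have hu' : deriv ut = fun x => -σ * deriv vt x := funext fun x => (ode1 x).symm
  have ddu : ∀ x, deriv (deriv ut) x = -σ * deriv (deriv vt) x := by
    intro x
    rw [hu']
    exact ((ddv x).const_mul (-σ)).deriv
  have dp : ∀ x, HasDerivAt (fun y => pfn γ (vt y)) (pderivfn γ (vt x) * deriv vt x) x :=
    fun x => (pfn_hasDeriv γ (vt x) (pos x)).comp x (dv x)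
  have hconst : ∀ x y, (2 * μ + lam) * σ * deriv vt x + (σ ^ 2 * vt x + pfn γ (vt x))
      = (2 * μ + lam) * σ * deriv vt y + (σ ^ 2 * vt y + pfn γ (vt y)) := by
    have hD : ∀ x, HasDerivAt (fun x => (2 * μ + lam) * σ * deriv vt x
        + (σ ^ 2 * vt x + pfn γ (vt x))) 0 x := by
      intro x
      have h1 := ((ddv x).const_mul ((2 * μ + lam) * σ)).add
        (((dv x).const_mul (σ ^ 2)).add (dp x))
      have h2 := ode2 x
      rw [ddu, (dp x).deriv, ← ode1] at h2
      have h3 : (2 * μ + lam) * σ * deriv (deriv vt) x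
          + (σ ^ 2 * deriv vt x + pderivfn γ (vt x) * deriv vt x) = 0 := by linarith
      rw [h3] at h1
      exact h1
    exact is_const_of_deriv_eq_zero (fun x => (hD x).differentiableAt) (fun x => (hD x).deriv)
  have hks : (2 * μ + lam) * σ ≠ 0 := mul_ne_zero hk.ne' hσ
  set K := (2 * μ + lam) * σ * deriv vt 0 + (σ ^ 2 * vt 0 + pfn γ (vt 0)) with hK
  have hv' : ∀ x, deriv vt x = (K - (σ ^ 2 * vt x + pfn γ (vt x))) / ((2 * μ + lam) * σ) := by
    intro x
    rw [eq_div_iff hks]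
    linarith [hconst x 0]
  have hlim : Tendsto (deriv vt) atBot
      (𝓝 ((K - (σ ^ 2 * vL + pfn γ vL)) / ((2 * μ + lam) * σ))) := by
    have e : deriv vt = fun x => (K - (σ ^ 2 * vt x + pfn γ (vt x))) / ((2 * μ + lam) * σ) :=
      funext hv'
    rw [e]
    exact (tendsto_const_nhds.sub ((lLv.const_mul _).add
      ((pfn_hasDeriv γ vL hvL).continuousAt.tendsto.comp lLv))).div_const _
  have hK0 := lim_deriv_zero vt (deriv vt) vL _ dv lLv hlim
  have hKL : K = σ ^ 2 * vL + pfn γ vL := by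
    rcases div_eq_zero_iff.1 hK0 with h | h
    · linarith
    · exact absurd h hks
  have hode : ∀ x, (2 * μ + lam) * σ * deriv vt x
      = (σ ^ 2 * vL + pfn γ vL) - (σ ^ 2 * vt x + pfn γ (vt x)) := by
    intro x
    linarith [hconst x 0]
  have hGmin : σ ^ 2 * (min vL vR) + pfn γ (min vL vR) = σ ^ 2 * vL + pfn γ vL := by
    rcases min_choice vL vR with h | h <;> rw [h]
    exact hRH.symm
  have hGmax : σ ^ 2 * (max vL vR) + pfn γ (max vL vR) = σ ^ 2 * vL + pfn γ vL := by
    rcases max_choice vL vR with h | h <;> rw [h]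
    exact hRH.symm
  have hmm : min vL vR < max vL vR := min_lt_max.2 hne
  have hmin0 : 0 < min vL vR := lt_min hvL hvR
  have hcrit : ∀ x, deriv vt x = 0 → σ ^ 2 * vt x + pfn γ (vt x) = σ ^ 2 * vL + pfn γ vL := by
    intro x hx
    have := hode x
    rw [hx] at this
    linarith
  have hrange : ∀ ξ, min vL vR ≤ vt ξ ∧ vt ξ ≤ max vL vR := by
    intro ξ
    constructor
    · by_contra hn
      push Not at hn
      obtain ⟨x, hx⟩ := exists_max_of_lims (fun x => - vt x) (-vL) (-vR) ξ sv.continuous.neg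
        lLv.neg lRv.neg (by linarith [min_le_left vL vR]) (by linarith [min_le_right vL vR])
      have hx' : ∀ y, vt x ≤ vt y := fun y => by linarith [hx y]
      have hmin : IsLocalMin vt x := Filter.Eventually.of_forall hx'
      have h1 := hcrit x hmin.deriv_eq_zero
      have h2 := G_out (k := σ ^ 2) hγ (pos x) (lt_of_le_of_lt (hx' ξ) hn) hmm
      rw [hGmin, hGmax, h1, max_self] at h2
      exact lt_irrefl _ h2
    · by_contra hn
      push Not at hn
      obtain ⟨x, hx⟩ := exists_max_of_lims vt vL vR ξ sv.continuous
        lLv lRv (by linarith [le_max_left vL vR]) (by linarith [le_max_right vL vR])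
      have hmin : IsLocalMax vt x := Filter.Eventually.of_forall hx
      have h1 := hcrit x hmin.deriv_eq_zero
      have h2 := G_out (k := σ ^ 2) hγ hmin0 hmm (lt_of_lt_of_le hn (hx ξ))
      rw [hGmin, hGmax, h1, max_self] at h2
      exact lt_irrefl _ h2
  have hsign : ∀ x, 0 ≤ σ * deriv vt x := by
    intro x
    have h1 := G_in (k := σ ^ 2) hγ hmin0 (hrange x).1 (hrange x).2 (hGmin.trans hGmax.symm)
    have h2 := hode x
    have h3 : 0 ≤ (2 * μ + lam) * (σ * deriv vt x) := by
      rw [← mul_assoc, h2]; linarith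
    exact nonneg_of_mul_nonneg_right h3 hk
  refine ⟨hrange, ?_, ?_⟩
  · intro x
    rw [eq_div_iff hσ]
    have h1 : HasDerivAt (heff μ lam vt ut) (deriv ut x - (2 * μ + lam) * deriv (deriv vt) x) x :=
      (du x).sub ((ddv x).const_mul _)
    rw [h1.deriv]
    have h2 := ode2 x
    rw [ddu] at h2
    linarith
  · have e : ∀ x, deriv (fun y => pfn γ (vt y)) x = pderivfn γ (vt x) * deriv vt x :=
      fun x => (dp x).deriv
    simp only [e]
    refine mono_int' (fun y => pfn γ (vt y)) _ _ _ (-σ) (neg_ne_zero.2 hσ) dp ?_ ?_ ?_ ?_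
    · refine Continuous.mul ?_ sv2.continuous
      unfold pderivfn
      exact continuous_const.mul (sv.continuous.rpow_const fun x => Or.inl (pos x).ne')
    · intro x
      have h1 : 0 < vt x ^ (-γ - 1) := Real.rpow_pos_of_pos (pos x) _
      have h2 : -σ * (pderivfn γ (vt x) * deriv vt x) = γ * vt x ^ (-γ - 1) * (σ * deriv vt x) := by
        unfold pderivfn; ring
      rw [h2]
      have := hsign x
      positivity
    · exact (pfn_hasDeriv γ vL hvL).continuousAt.tendsto.comp lLv
    · exact (pfn_hasDeriv γ vR hvR).continuousAt.tendsto.comp lRv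

lemma Mconst_bdd (γ vp : ℝ) (hγ : 1 < γ) (hvp : 0 < vp) :
    ∃ K, ∀ w ∈ Icc (vp / 2) (2 * vp), |Mconst γ w| ≤ K := by
  have h : ContinuousOn (Mconst γ) (Icc (vp / 2) (2 * vp)) := by
    intro w hw
    have w0 : 0 < w := by linarith [hw.1]
    apply ContinuousAt.continuousWithinAt
    have h1 : ContinuousAt (sigm γ) w := by
      unfold sigm
      exact (continuousAt_const.mul (Real.continuousAt_rpow_const _ _ (Or.inl w0.ne'))).sqrt
    have h2 : ContinuousAt (pfn γ) w := (pfn_hasDeriv γ w w0).continuousAt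
    have h3 : 0 < sigm γ w := Real.sqrt_pos.2 (by positivity)
    have h4 : 0 < pfn γ w := Real.rpow_pos_of_pos w0 _
    unfold Mconst alpham
    refine ContinuousAt.mul ((continuousAt_const.mul (h1.pow 4)).mul (continuousAt_id.pow 2)) ?_
    refine continuousAt_const.div ((continuousAt_const.mul h1).mul h2) ?_
    positivity
  obtain ⟨K, hK⟩ := isCompact_Icc.exists_bound_of_continuousOn h
  exact ⟨K, hK⟩

/-- one of the integrals in the shift equation -/
lemma int_bound (f : Spc → ℝ) (g : ℝ → ℝ) (c D d : ℝ) (hD : 0 ≤ D)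
    (hg : Integrable g) (hd : ∫ ξ, g ξ ≤ d) (hf : ∀ x, |f x| ≤ D * g (x 0 - c)) :
    |∫ x in cell, f x| ≤ D * d := by
  have h1 : Integrable (fun y => D * g (y - c)) := (hg.comp_sub_right c).const_mul D
  have h2 : Integrable (fun x : Spc => D * g (x 0 - c)) (volume.restrict cell) :=
    mp_cell.integrable_comp_of_integrable h1
  have h3 := norm_integral_le_of_norm_le (f := f) h2 (Filter.Eventually.of_forall (f := ae _) hf)
  have h4 : ∫ x in cell, D * g (x 0 - c) = D * ∫ y, g y := by
    have := integral_map (μ := volume.restrict cell) (φ := fun x : Spc => x 0)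
      mp_cell.measurable.aemeasurable (f := fun y => D * g (y - c))
      (by rw [mp_cell.map_eq]; exact h1.aestronglyMeasurable)
    rw [mp_cell.map_eq] at this
    rw [← this, integral_const_mul, integral_sub_right_eq_self]
  rw [h4] at h3
  exact h3.trans (mul_le_mul_of_nonneg_left hd hD)

/-- the algebra of the shift bound -/
lemma shift_bound (M K δ A L l B σ c : ℝ) (a g h w z : Spc → ℝ) (q : ℝ → ℝ)
    (hM : |M| ≤ K) (hδ : 0 < δ) (hA : 0 ≤ A) (hL : 0 ≤ L) (hl : 0 < l) (hB : 0 ≤ B) (hσ : l ≤ σ ^ 2)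
    (hq : Integrable (fun x => |q x|)) (hqi : ∫ x, |q x| ≤ δ)
    (ha : ∀ x, |a x| ≤ A) (hg : ∀ x, g x = q (x 0 - c)) (hh : ∀ x, h x = q (x 0 - c) / σ)
    (hw : ∀ x, |w x| ≤ L * B) (hz : ∀ x, |z x| ≤ B) :
    |-(M / δ) * ((∫ x in cell, (a x / σ) * h x * w x) - ∫ x in cell, a x * g x * z x)|
      ≤ K * (A * (L / l + 1)) * B := by
  have hσ2 : 0 < σ ^ 2 := lt_of_lt_of_le hl hσ
  have i1 : |∫ x in cell, (a x / σ) * h x * w x| ≤ (A / l * (L * B)) * δ := by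
    refine int_bound _ (fun x => |q x|) c _ δ (by positivity) hq hqi ?_
    intro x
    have e : (a x / σ) * h x * w x = (a x / σ ^ 2 * w x) * q (x 0 - c) := by
      rw [hh]; ring
    rw [e, abs_mul, abs_mul, abs_div, abs_of_pos hσ2]
    gcongr
    · exact ha x
    · exact hw x
  have i2 : |∫ x in cell, a x * g x * z x| ≤ (A * B) * δ := by
    refine int_bound _ (fun x => |q x|) c _ δ (by positivity) hq hqi ?_
    intro x
    have e : a x * g x * z x = (a x * z x) * q (x 0 - c) := by
      rw [hg]; ring
    rw [e, abs_mul, abs_mul]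
    gcongr
    · exact ha x
    · exact hz x
  have hK : 0 ≤ K := (abs_nonneg _).trans hM
  rw [abs_mul, abs_neg, abs_div, abs_of_pos hδ]
  calc |M| / δ * |(∫ x in cell, (a x / σ) * h x * w x) - ∫ x in cell, a x * g x * z x|
      ≤ K / δ * ((A / l * (L * B)) * δ + (A * B) * δ) := by
        gcongr
        exact (abs_sub _ _).trans (add_le_add i1 i2)
    _ = K * (A * (L / l + 1)) * B := by
        field_simp

lemma near_bounds (γ vp w : ℝ) (hγ : 1 < γ) (hvp : 0 < vp) (hw : 0 < w)
    (h1 : pfn γ vp / 2 < pfn γ w) (h2 : pfn γ w < 2 * pfn γ vp) : vp / 2 ≤ w ∧ w ≤ 2 * vp := by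
  have hp : 0 < pfn γ vp := Real.rpow_pos_of_pos hvp _
  have t : (2:ℝ) ≤ 2 ^ γ := by
    have := Real.rpow_le_rpow_of_exponent_le (x := 2) (by norm_num) hγ.le
    simpa using this
  have e1 : pfn γ (vp / 2) = 2 ^ γ * pfn γ vp := by
    unfold pfn
    rw [Real.div_rpow hvp.le (by norm_num), Real.rpow_neg (by norm_num : (0:ℝ) ≤ 2)]
    field_simp
  have e2 : 2 ^ γ * pfn γ (2 * vp) = pfn γ vp := by
    unfold pfn
    rw [Real.mul_rpow (by norm_num) hvp.le, Real.rpow_neg (by norm_num : (0:ℝ) ≤ 2)]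
    have : (2:ℝ) ^ γ ≠ 0 := by positivity
    field_simp
  have hp2 : 0 < pfn γ (2 * vp) := Real.rpow_pos_of_pos (by linarith) _
  constructor
  · by_contra hn
    push Not at hn
    have := pfn_anti γ hγ hw hn.le
    nlinarith
  · by_contra hn
    push Not at hn
    have := pfn_anti γ hγ (by linarith) hn.le
    nlinarith

/-- estimate (3.15) on the shift derivatives: under the a priori
smallness of the perturbation in `L^∞`, the shifts defined by the ODE (3.6) satisfy
`|Ẋᵢ(t)| ≤ C ‖(v - ṽ)(t,·)‖_{L^∞(Ω)}`. The `L^∞` norm is encoded through an arbitrary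
pointwise bound `B`. -/
theorem shift_derivative_bound
    (γ μ lam : ℝ) (hγ : 1 < γ) (hμ : 0 < μ) (hlam : 0 ≤ 2*μ + 3*lam)
    (vplus uplus : ℝ) (hvplus : 0 < vplus) :
    ∃ δ0 > 0, ∃ ε1 > 0, ∃ C > 0,
      ∀ (vminus uminus vm um σ1s σ2s σ1 σ2 δ1 δ2 ν1 ν2 T : ℝ)
        (vt1 ut1 vt2 ut2 : ℝ → ℝ) (v : ℝ → Spc → ℝ) (X1 X2 dX1 dX2 : ℝ → ℝ),
        RHLax γ σ1s σ2s vminus uminus vm um vplus uplus →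
        δ1 = |pfn γ vminus - pfn γ vm| → 0 < δ1 → δ1 < δ0 →
        δ2 = |pfn γ vm - pfn γ vplus| → 0 < δ2 → δ2 < δ0 →
        ViscousShock γ μ lam σ1s vminus uminus vm um vt1 ut1 →
        ViscousShock γ μ lam σ2s vm um vplus uplus vt2 ut2 →
        σ1s * vminus = σ1 - uminus → σ2s * vm = σ2 - um → σ1 < σ2 →
        δ1 < ν1 → ν1 ≤ Real.sqrt δ1 → δ2 < ν2 → ν2 ≤ Real.sqrt δ2 →
        0 < T →
        (∀ t, Measurable (v t)) →
        (∀ t ∈ Icc (0:ℝ) T, ∀ x : Spc, vplus / 2 ≤ v t x ∧ v t x ≤ 2 * vplus) →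
        (∀ t ∈ Icc (0:ℝ) T, ∀ x : Spc,
          |v t x - vcompY vm σ1 σ2 vt1 vt2 t (X1 t) (X2 t) (x 0)| ≤ C * ε1) →
        ShiftODE γ μ lam vm σ1 σ2 σ1s σ2s δ1 δ2 ν1 ν2 T vt1 ut1 vt2 ut2 v X1 X2 dX1 dX2 →
        ∀ t ∈ Icc (0:ℝ) T, ∀ B : ℝ, 0 ≤ B →
          (∀ x : Spc, |v t x - vcompY vm σ1 σ2 vt1 vt2 t (X1 t) (X2 t) (x 0)| ≤ B) →
          |dX1 t| ≤ C * B ∧ |dX2 t| ≤ C * B := by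
  have hk : 0 < 2 * μ + lam := by linarith
  have hP : 0 < pfn γ vplus := Real.rpow_pos_of_pos hvplus _
  obtain ⟨K0, hK0⟩ := Mconst_bdd γ vplus hγ hvplus
  set K := |K0| + 1 with hKdef
  have hKpos : 0 < K := by positivity
  set δ0 := pfn γ vplus / 4 with hδ0
  set A := 1 + 2 * Real.sqrt δ0 with hAdef
  set l := γ * (2 * vplus) ^ (-γ - 1) with hldef
  set L := γ * (vplus / 2) ^ (-γ - 1) with hLdef
  have hl : 0 < l := by positivity
  have hL : 0 < L := by positivity
  have hA : 0 < A := by positivity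
  refine ⟨δ0, by positivity, 1, one_pos, K * (A * (L / l + 1)), by positivity, ?_⟩
  intro vminus uminus vm um σ1s σ2s σ1 σ2 δ1 δ2 ν1 ν2 T vt1 ut1 vt2 ut2 v X1 X2 dX1 dX2
    hRH hδ1 hδ1p hδ1s hδ2 hδ2p hδ2s hS1 hS2 _ _ _ hν1 hν1' hν2 hν2' hT _ hvb _ hODE t ht B hB hBv
  obtain ⟨pminus, pm, pplus, rh1v, rh1u, lax1v, lax1u, rh2v, rh2u, lax2v, lax2u⟩ := hRH
  have a1 := pfn_anti γ hγ pm lax1v.le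
  have a2 := pfn_anti γ hγ pm lax2v.le
  have hδ1e : δ1 = pfn γ vm - pfn γ vminus := by
    rw [hδ1, abs_of_nonpos (by linarith)]; ring
  have hδ2e : δ2 = pfn γ vm - pfn γ vplus := by
    rw [hδ2, abs_of_nonneg (by linarith)]
  obtain ⟨bm1, bm2⟩ := near_bounds γ vplus vm hγ hvplus pm (by linarith) (by linarith)
  obtain ⟨bn1, bn2⟩ := near_bounds γ vplus vminus hγ hvplus pminus (by linarith) (by linarith)
  have hσ1 : σ1s ≠ 0 := by
    rintro rfl
    linarith
  have hσ2 : σ2s ≠ 0 := by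
    rintro rfl
    linarith
  have e1 : σ1s ^ 2 * (vminus - vm) = pfn γ vm - pfn γ vminus := by
    rw [← rh1v] at rh1u
    linarith
  have e2 : σ2s ^ 2 * (vplus - vm) = pfn γ vm - pfn γ vplus := by
    rw [← rh2v] at rh2u
    linarith
  have hv2 : (0:ℝ) < vplus / 2 := by linarith
  have s1 : l ≤ σ1s ^ 2 := by
    have := (pfn_slope γ hγ hv2 bm1 lax1v bn2).1
    rw [← e1] at this
    exact le_of_mul_le_mul_right this (by linarith)
  have s2 : l ≤ σ2s ^ 2 := by
    have := (pfn_slope γ hγ hv2 bm1 lax2v (show vplus ≤ 2 * vplus by linarith)).1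
    rw [← e2] at this
    exact le_of_mul_le_mul_right this (by linarith)
  obtain ⟨r1, h1, i1, j1⟩ := shock_props hγ hk hσ1 pminus pm lax1v.ne' (by linarith) hS1
  obtain ⟨r2, h2, i2, j2⟩ := shock_props hγ hk hσ2 pm pplus lax2v.ne (by linarith) hS2
  rw [abs_sub_comm, ← hδ1] at j1
  rw [abs_sub_comm, ← hδ2] at j2
  rw [min_eq_right lax1v.le, max_eq_left lax1v.le] at r1
  rw [min_eq_left lax2v.le, max_eq_right lax2v.le] at r2
  have hM : |Mconst γ vm| ≤ K :=
    (hK0 vm ⟨bm1, bm2⟩).trans (by rw [hKdef]; linarith [le_abs_self K0])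
  have n1 : ν1 ≤ Real.sqrt δ0 := hν1'.trans (Real.sqrt_le_sqrt hδ1s.le)
  have n2 : ν2 ≤ Real.sqrt δ0 := hν2'.trans (Real.sqrt_le_sqrt hδ2s.le)
  have w1 : ∀ ξ, 1 ≤ wgt γ δ1 ν1 vm vt1 ξ ∧ wgt γ δ1 ν1 vm vt1 ξ ≤ 1 + Real.sqrt δ0 := by
    intro ξ
    have u1 := pfn_anti γ hγ pm (r1 ξ).1
    have u2 := pfn_anti γ hγ (lt_of_lt_of_le pm (r1 ξ).1) (r1 ξ).2
    have hν0 : 0 ≤ ν1 := by linarith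
    unfold wgt
    constructor
    · have : 0 ≤ ν1 * (pfn γ vm - pfn γ (vt1 ξ)) / δ1 :=
        div_nonneg (mul_nonneg hν0 (by linarith)) hδ1p.le
      linarith
    · have : ν1 * (pfn γ vm - pfn γ (vt1 ξ)) / δ1 ≤ ν1 := by
        rw [div_le_iff₀ hδ1p]
        exact mul_le_mul_of_nonneg_left (by linarith) hν0
      linarith
  have w2 : ∀ ξ, 1 ≤ wgt γ δ2 ν2 vm vt2 ξ ∧ wgt γ δ2 ν2 vm vt2 ξ ≤ 1 + Real.sqrt δ0 := by
    intro ξ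
    have u1 := pfn_anti γ hγ pm (r2 ξ).1
    have u2 := pfn_anti γ hγ (lt_of_lt_of_le pm (r2 ξ).1) (r2 ξ).2
    have hν0 : 0 ≤ ν2 := by linarith
    unfold wgt
    constructor
    · have : 0 ≤ ν2 * (pfn γ vm - pfn γ (vt2 ξ)) / δ2 :=
        div_nonneg (mul_nonneg hν0 (by linarith)) hδ2p.le
      linarith
    · have : ν2 * (pfn γ vm - pfn γ (vt2 ξ)) / δ2 ≤ ν2 := by
        rw [div_le_iff₀ hδ2p]
        exact mul_le_mul_of_nonneg_left (by linarith) hν0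
      linarith
  have hacomp : ∀ x : Spc,
      |acompY γ vm σ1 σ2 δ1 δ2 ν1 ν2 vt1 vt2 t (X1 t) (X2 t) (x 0)| ≤ A := by
    intro x
    have u1 := w1 (x 0 - σ1*t - X1 t)
    have u2 := w2 (x 0 - σ2*t - X2 t)
    unfold acompY
    rw [abs_of_nonneg (by linarith)]
    linarith
  have hplip : ∀ x : Spc, |pfn γ (v t x)
      - pfn γ (vcompY vm σ1 σ2 vt1 vt2 t (X1 t) (X2 t) (x 0))| ≤ L * B := by
    intro x
    refine (pfn_lip γ hγ hv2 (hvb t ht x).1 ?_).trans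
      (mul_le_mul_of_nonneg_left (hBv x) hL.le)
    unfold vcompY
    linarith [(r1 (x 0 - σ1*t - X1 t)).1, (r2 (x 0 - σ2*t - X2 t)).1]
  obtain ⟨-, -, hode⟩ := hODE
  obtain ⟨-, -, d1, d2⟩ := hode t ht
  constructor
  · rw [d1]
    unfold shiftF1
    exact shift_bound (Mconst γ vm) K δ1 A L l B σ1s (σ1*t + X1 t) _ _ _ _ _
      (deriv (fun y => pfn γ (vt1 y))) hM hδ1p hA.le hL.le hl hB s1 i1 j1 hacomp
      (fun x => by rw [sub_sub]) (fun x => by rw [h1, sub_sub]) hplip hBv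
  · rw [d2]
    unfold shiftF2
    exact shift_bound (Mconst γ vm) K δ2 A L l B σ2s (σ2*t + X2 t) _ _ _ _ _
      (deriv (fun y => pfn γ (vt2 y))) hM hδ2p hA.le hL.le hl hB s2 i2 j2 hacomp
      (fun x => by rw [sub_sub]) (fun x => by rw [h2, sub_sub]) hplip hBv

end NS3D
end
end
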